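/- arXiv:2206.06099 — 3 statements merged into one kernel-verified Lean document; each statement's English description precedes it below -/
import Mathlib

section
/- Let M be a compact metric space. Then the following two conditions are equivalent: (1) the Lebesgue covering dimension of M is finite; (2) there exists a total order T on M such that Snake(M,T) < ∞. -/
open Metric Set




/-- The pair `(U₁, U₂)` contains a snake of length `s` with respect to the
strict total order `T`: a `T`-increasing sequence `a₀ <_T a₁ <_T ⋯ <_T a_s`
with even-indexed points in `U₁` and odd-indexed points in `U₂`. -/
def HasSnake {M : Type*} (T : M → M → Prop) (U₁ U₂ : Set M) (s : ℕ) : Prop :=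
  ∃ a : Fin (s + 1) → M,
    (∀ i j : Fin (s + 1), i < j → T (a i) (a j)) ∧
    (∀ i : Fin (s + 1), Even (i : ℕ) → a i ∈ U₁) ∧
    (∀ i : Fin (s + 1), Odd (i : ℕ) → a i ∈ U₂)

/-- The snake number `Snake_T(x, y)`: the greatest `s` such that for every `ε > 0`
the pair `(B_ε(x), B_ε(y))` contains a snake of length `s`; `∞` if no greatest exists. -/
noncomputable def snakeNum {M : Type*} [MetricSpace M] (T : M → M → Prop) (x y : M) : ℕ∞ :=
  ⨆ s ∈ {s : ℕ | ∀ ε : ℝ, 0 < ε → HasSnake T (ball x ε) (ball y ε) s}, (s : ℕ∞)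

/-- The snake number `Snake(M, T)` of the ordered metric space: the supremum of
`Snake_T(x, y)` over all pairs of distinct points. -/
noncomputable def snakeNumSpace {M : Type*} [MetricSpace M] (T : M → M → Prop) : ℕ∞ :=
  ⨆ (x : M) (y : M) (_ : x ≠ y), snakeNum T x y

/-- The Lebesgue covering dimension of `M` is at most `n`: every finite open cover
has a finite open refinement in which no point belongs to more than `n + 1` sets. -/
def CovDimLE (M : Type*) [TopologicalSpace M] (n : ℤ) : Prop :=
  ∀ 𝒰 : Set (Set M), 𝒰.Finite → (∀ U ∈ 𝒰, IsOpen U) → ⋃₀ 𝒰 = Set.univ →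
    ∃ 𝒱 : Set (Set M), 𝒱.Finite ∧ (∀ V ∈ 𝒱, IsOpen V) ∧ ⋃₀ 𝒱 = Set.univ ∧
      (∀ V ∈ 𝒱, ∃ U ∈ 𝒰, V ⊆ U) ∧
      ∀ x : M, ({V ∈ 𝒱 | x ∈ V}.ncard : ℤ) ≤ n + 1


/-- Separate finitely many disjoint closed sets inside a cover. -/
lemma sep_family {M : Type*} [MetricSpace M] {ι : Type*} [Finite ι] (𝒰 : Set (Set M))
    (hU : ∀ U ∈ 𝒰, IsOpen U) (K : ι → Set M) (hc : ∀ i, IsClosed (K i))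
    (hd : ∀ i j, i ≠ j → Disjoint (K i) (K j)) (hK : ∀ i, ∃ U ∈ 𝒰, K i ⊆ U) :
    ∃ 𝒱 : Set (Set M), 𝒱.Finite ∧ (∀ V ∈ 𝒱, IsOpen V) ∧ (∀ V ∈ 𝒱, ∃ U ∈ 𝒰, V ⊆ U) ∧
      (∀ i, K i ⊆ ⋃₀ 𝒱) ∧ ∀ x : M, ({V ∈ 𝒱 | x ∈ V}.ncard) ≤ 1 := by
  choose U hU1 hU2 using hK
  let V : ι → Set M := fun i => U i ∩ ⋂ j, {x | i ≠ j → infEDist x (K i) < infEDist x (K j)}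
  refine ⟨range V, finite_range V, ?_, ?_, ?_, ?_⟩
  · rintro _ ⟨i, rfl⟩
    refine (hU _ (hU1 i)).inter (isOpen_iInter_of_finite fun j => ?_)
    by_cases h : i = j
    · simp [h]
    · simp only [ne_eq, h, not_false_eq_true, forall_const]
      exact isOpen_lt continuous_infEDist continuous_infEDist
  · rintro _ ⟨i, rfl⟩
    exact ⟨U i, hU1 i, inter_subset_left⟩
  · intro i x hx
    refine ⟨V i, ⟨i, rfl⟩, hU2 i hx, mem_iInter.2 fun j hij => ?_⟩
    rw [infEDist_zero_of_mem hx]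
    rw [pos_iff_ne_zero]
    intro h0
    have := (mem_iff_infEDist_zero_of_closed (hc j)).2 h0
    exact (Set.disjoint_left.1 (hd i j hij)) hx this
  · intro x
    have : Finite {W ∈ range V | x ∈ W} := (finite_range V).subset (fun _ h => h.1)
    rw [Set.ncard_le_one_iff_subsingleton]
    rintro _ ⟨⟨i, rfl⟩, hi⟩ _ ⟨⟨j, rfl⟩, hj⟩
    by_contra hne
    have hij : i ≠ j := fun h => hne (by rw [h])
    have h1 := mem_iInter.1 hi.2 j hij
    have h2 := mem_iInter.1 hj.2 i hij.symm
    exact lt_asymm h1 h2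

/-- Multiplicity induction. -/
lemma level_cover {M : Type*} [MetricSpace M] (𝒰 : Set (Set M))
    (hU : ∀ U ∈ 𝒰, IsOpen U) (hcov : ⋃₀ 𝒰 = univ) (B m : ℕ) (F : ℕ → Set M)
    (hF : ∀ i, IsClosed (F i)) (hFU : ∀ i < B, ∃ U ∈ 𝒰, F i ⊆ U)
    (S : M → Finset ℕ) (hS : ∀ x i, i ∈ S x ↔ i < B ∧ x ∈ F i)
    (hfin : {x | m + 2 ≤ (S x).card}.Finite) (j : ℕ) (hj : j ≤ m + 1) :
    ∃ 𝒱 : Set (Set M), 𝒱.Finite ∧ (∀ V ∈ 𝒱, IsOpen V) ∧ (∀ V ∈ 𝒱, ∃ U ∈ 𝒰, V ⊆ U) ∧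
      (∀ x, m + 2 ≤ (S x).card + j → x ∈ ⋃₀ 𝒱) ∧ ∀ x : M, ({V ∈ 𝒱 | x ∈ V}.ncard) ≤ j + 1 := by
  induction j with
  | zero =>
    have : Finite {x | m + 2 ≤ (S x).card} := hfin
    obtain ⟨𝒱, h1, h2, h3, h4, h5⟩ := sep_family 𝒰 hU
      (fun p : {x | m + 2 ≤ (S x).card} => ({(p : M)} : Set M)) (fun _ => isClosed_singleton)
      (fun i j hij => by
        rw [Set.disjoint_singleton]; exact fun h => hij (Subtype.ext h))
      (fun p => by
        have : (p : M) ∈ ⋃₀ 𝒰 := by rw [hcov]; trivial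
        obtain ⟨U, hU, hp⟩ := this
        exact ⟨U, hU, by simpa using hp⟩)
    exact ⟨𝒱, h1, h2, h3, fun x hx => h4 ⟨x, hx⟩ rfl, h5⟩
  | succ j ih =>
    obtain ⟨𝒱, h1, h2, h3, h4, h5⟩ := ih (by omega)
    let k := m + 1 - j
    have hk : 1 ≤ k := by omega
    let I := {s : Finset ℕ // s ∈ (Finset.range B).powersetCard k}
    let K : I → Set M := fun s => (⋂ i ∈ s.1, F i) \ ⋃₀ 𝒱
    have hI : ∀ s : I, s.1 ⊆ Finset.range B ∧ s.1.card = k := fun s => Finset.mem_powersetCard.1 s.2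
    obtain ⟨𝒲, g1, g2, g3, g4, g5⟩ := sep_family 𝒰 hU K
      (fun s => (isClosed_biInter fun i _ => hF i).sdiff (isOpen_sUnion h2))
      (fun s t hst => by
        rw [Set.disjoint_left]
        rintro x ⟨hx, hxV⟩ ⟨hx', -⟩
        apply hxV
        apply h4
        have hsub : s.1 ∪ t.1 ⊆ S x := by
          intro i hi
          rw [hS]
          rcases Finset.mem_union.1 hi with hi | hi
          · exact ⟨Finset.mem_range.1 ((hI s).1 hi), mem_iInter₂.1 hx i hi⟩
          · exact ⟨Finset.mem_range.1 ((hI t).1 hi), mem_iInter₂.1 hx' i hi⟩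
        have hlt : k < (s.1 ∪ t.1).card := by
          by_contra hle
          push Not at hle
          have e1 := Finset.eq_of_subset_of_card_le (Finset.subset_union_left (s₁ := s.1) (s₂ := t.1))
            (by rw [(hI s).2]; exact hle)
          have e2 := Finset.eq_of_subset_of_card_le (Finset.subset_union_right (s₁ := s.1) (s₂ := t.1))
            (by rw [(hI t).2]; exact hle)
          exact hst (Subtype.ext (e1.trans e2.symm))
        have := Finset.card_le_card hsub
        omega)
      (fun s => by
        have hne : s.1.Nonempty := by
          rw [← Finset.card_pos, (hI s).2]; omega
        obtain ⟨i, hi⟩ := hne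
        obtain ⟨U, hU, hFi⟩ := hFU i (Finset.mem_range.1 ((hI s).1 hi))
        exact ⟨U, hU, fun x hx => hFi (mem_iInter₂.1 hx.1 i hi)⟩)
    refine ⟨𝒱 ∪ 𝒲, h1.union g1, ?_, ?_, ?_, ?_⟩
    · rintro V (h | h)
      exacts [h2 V h, g2 V h]
    · rintro V (h | h)
      exacts [h3 V h, g3 V h]
    · intro x hx
      rw [sUnion_union]
      by_cases hxV : x ∈ ⋃₀ 𝒱
      · exact Or.inl hxV
      · right
        obtain ⟨t, ht, htc⟩ := Finset.exists_subset_card_eq (s := S x) (n := k) (by omega)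
        refine g4 ⟨t, Finset.mem_powersetCard.2 ⟨?_, htc⟩⟩ ⟨?_, hxV⟩
        · intro i hi
          exact Finset.mem_range.2 ((hS x i).1 (ht hi)).1
        · exact mem_iInter₂.2 fun i hi => ((hS x i).1 (ht hi)).2
    · intro x
      have : {V ∈ 𝒱 ∪ 𝒲 | x ∈ V} = {V ∈ 𝒱 | x ∈ V} ∪ {V ∈ 𝒲 | x ∈ V} := by
        ext V; simp only [mem_ofPred_eq, mem_union]; tauto
      rw [this]
      have := Set.ncard_union_le {V ∈ 𝒱 | x ∈ V} {V ∈ 𝒲 | x ∈ V}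
      have := h5 x
      have := g5 x
      omega

/-- snake with `n` points below `x`. -/
def SnB {M : Type*} [LinearOrder M] (U V : Set M) (n : ℕ) (x : M) : Prop :=
  ∃ a : ℕ → M, (∀ i j, i < j → j < n → a i < a j) ∧ (∀ i < n, Even i → a i ∈ U) ∧
    (∀ i < n, Odd i → a i ∈ V) ∧ ∀ i < n, a i ≤ x

lemma SnB.snoc {M : Type*} [LinearOrder M] {U V : Set M} {n : ℕ} {x : M} (a : ℕ → M)
    (h1 : ∀ i j, i < j → j < n → a i < a j) (h2 : ∀ i < n, Even i → a i ∈ U)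
    (h3 : ∀ i < n, Odd i → a i ∈ V) (h4 : ∀ i < n, a i < x) (h5 : Even n → x ∈ U)
    (h6 : Odd n → x ∈ V) : SnB U V (n + 1) x := by
  refine ⟨fun i => if i < n then a i else x, ?_, ?_, ?_, ?_⟩
  · intro i j hij hj
    have hi : i < n := by omega
    by_cases hjn : j < n
    · simpa [hi, hjn] using h1 i j hij hjn
    · simpa [hi, hjn] using h4 i hi
  · intro i hi he
    by_cases hin : i < n
    · simpa [hin] using h2 i hin he
    · obtain rfl : i = n := by omega
      simpa using h5 he
  · intro i hi he
    by_cases hin : i < n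
    · simpa [hin] using h3 i hin he
    · obtain rfl : i = n := by omega
      simpa using h6 he
  · intro i hi
    by_cases hin : i < n
    · simpa [hin] using (h4 i hin).le
    · simp [hin]

lemma SnB.mono {M : Type*} [LinearOrder M] {U V : Set M} {n : ℕ} {x y : M} (h : SnB U V n x)
    (hxy : x ≤ y) : SnB U V n y := by
  obtain ⟨a, h1, h2, h3, h4⟩ := h
  exact ⟨a, h1, h2, h3, fun i hi => (h4 i hi).trans hxy⟩

/-- bounded monotone counting function separating `U`,`V`. -/
lemma box_count {M : Type*} [LinearOrder M] (U V : Set M) (hd : Disjoint U V) (m : ℕ)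
    (hm : ∀ x, ¬ SnB U V (m + 1) x) :
    ∃ c : M → ℕ, Monotone c ∧ (∀ x, c x ≤ m) ∧ ∀ x y, x < y → x ∈ U → y ∈ V → c x < c y := by
  classical
  let c : M → ℕ := fun x => Nat.findGreatest (fun n => SnB U V n x) m
  have hc : ∀ x, SnB U V (c x) x := fun x =>
    Nat.findGreatest_spec (P := fun n => SnB U V n x) (Nat.zero_le m)
      ⟨fun _ => x, by simp, by simp, by simp, by simp⟩
  have hle : ∀ x, c x ≤ m := fun x => Nat.findGreatest_le m
  have hmax : ∀ x n, n ≤ m + 1 → SnB U V n x → n ≤ c x := by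
    intro x n hn h
    rcases Nat.lt_or_ge m n with h' | h'
    · obtain rfl : n = m + 1 := by omega
      exact absurd h (hm x)
    · exact Nat.le_findGreatest h' h
  refine ⟨c, fun x y hxy => hmax _ _ ((hle x).trans (Nat.le_succ m)) ((hc x).mono hxy), hle, ?_⟩
  intro x y hxy hx hy
  obtain ⟨a, h1, h2, h3, h4⟩ := hc x
  have hl := hle x
  rcases Nat.even_or_odd (c x) with he | ho
  · exfalso
    have : SnB U V (c x + 1) x := by
      refine SnB.snoc a h1 h2 h3 ?_ (fun _ => hx) (fun h => absurd he (Nat.not_even_iff_odd.2 h))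
      intro i hi
      rcases Nat.lt_or_ge (i + 1) (c x) with h | h
      · exact (h1 i (i + 1) (by omega) h).trans_le (h4 _ h)
      · have hio : Odd i := by
          have e : c x = i + 1 := by omega
          rw [e] at he
          rcases Nat.even_or_odd i with h' | h'
          · exact absurd he (by simpa [Nat.even_add_one] using h')
          · exact h'
        refine lt_of_le_of_ne (h4 i hi) fun hh => ?_
        exact Set.disjoint_left.1 hd hx (hh ▸ h3 i hi hio)
    have := hmax x _ (by omega) this
    omega
  · have : SnB U V (c x + 1) y :=
      SnB.snoc a h1 h2 h3 (fun i hi => (h4 i hi).trans_lt hxy)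
        (fun h => absurd h (Nat.not_even_iff_odd.2 ho)) (fun _ => hy)
    exact hmax y _ (by omega) this

lemma SnB.hasSnake {M : Type*} [LinearOrder M] {U V : Set M} {n : ℕ} {x : M}
    (h : SnB U V (n + 1) x) : HasSnake (fun a b : M => a < b) U V n := by
  obtain ⟨a, h1, h2, h3, -⟩ := h
  exact ⟨fun i => a i, fun i j hij => h1 i j hij j.2, fun i hi => h2 i i.2 hi,
    fun i hi => h3 i i.2 hi⟩

lemma HasSnake.mono {M : Type*} {T : M → M → Prop} {U V U' V' : Set M} {n : ℕ}
    (h : HasSnake T U V n) (hU : U ⊆ U') (hV : V ⊆ V') : HasSnake T U' V' n := by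
  obtain ⟨a, h1, h2, h3⟩ := h
  exact ⟨a, h1, fun i hi => hU (h2 i hi), fun i hi => hV (h3 i hi)⟩

/-- A bounded monotone labelling with small fibres. -/
lemma exists_label {M : Type*} [MetricSpace M] [CompactSpace M] [LinearOrder M] (m : ℕ)
    (h : ∀ x y : M, x ≠ y → ∃ ε > 0, ¬ HasSnake (fun a b : M => a < b) (ball x ε) (ball y ε) m)
    (ε : ℝ) (hε : 0 < ε) :
    ∃ (c : M → ℕ) (B : ℕ), Monotone c ∧ (∀ x, c x < B) ∧ ∀ x y, c x = c y → dist x y < ε := by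
  classical
  have hr : ∀ p : M × M, ∃ r : ℝ, p.1 ≠ p.2 → 0 < r ∧ Disjoint (ball p.1 r) (ball p.2 r) ∧
      ¬ HasSnake (fun a b : M => a < b) (ball p.1 r) (ball p.2 r) m := by
    intro p
    by_cases hp : p.1 = p.2
    · exact ⟨0, fun h => absurd hp h⟩
    · obtain ⟨e, he, hs⟩ := h p.1 p.2 hp
      have hd : 0 < dist p.1 p.2 := dist_pos.2 hp
      refine ⟨min e (dist p.1 p.2 / 2), fun _ => ⟨by positivity, ?_, fun hh => hs ?_⟩⟩
      · apply ball_disjoint_ball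
        have := min_le_right e (dist p.1 p.2 / 2)
        linarith
      · exact hh.mono (ball_subset_ball (min_le_left _ _)) (ball_subset_ball (min_le_left _ _))
  choose r hr using hr
  have hK : IsCompact {p : M × M | ε ≤ dist p.1 p.2} :=
    (isClosed_le continuous_const (continuous_fst.dist continuous_snd)).isCompact
  have hne : ∀ p ∈ {p : M × M | ε ≤ dist p.1 p.2}, p.1 ≠ p.2 := by
    intro p hp
    exact dist_pos.1 (hε.trans_le hp)
  obtain ⟨t, ht1, ht2⟩ := hK.elim_nhds_subcover (fun p => ball p.1 (r p) ×ˢ ball p.2 (r p))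
    (fun p hp => prod_mem_nhds (ball_mem_nhds _ (hr p (hne p hp)).1)
      (ball_mem_nhds _ (hr p (hne p hp)).1))
  have hc : ∀ p : M × M, ∃ c : M → ℕ, p ∈ t → Monotone c ∧ (∀ x, c x ≤ m) ∧
      ∀ x y, x < y → x ∈ ball p.1 (r p) → y ∈ ball p.2 (r p) → c x < c y := by
    intro p
    by_cases hp : p ∈ t
    · obtain ⟨-, hd, hs⟩ := hr p (hne p (ht1 p hp))
      obtain ⟨c, hc⟩ := box_count _ _ hd m (fun x hx => hs hx.hasSnake)
      exact ⟨c, fun _ => hc⟩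
    · exact ⟨fun _ => 0, fun h => absurd h hp⟩
  choose c hc using hc
  have hmono : Monotone (fun x => ∑ p ∈ t, c p x) :=
    fun x y hxy => Finset.sum_le_sum fun p hp => (hc p hp).1 hxy
  have key : ∀ x y, x < y → (∑ p ∈ t, c p x) = ∑ p ∈ t, c p y → dist x y < ε := by
    intro x y hxy he
    by_contra hd
    push Not at hd
    have := ht2 (show (x, y) ∈ {p : M × M | ε ≤ dist p.1 p.2} from hd)
    simp only [mem_iUnion, exists_prop] at this
    obtain ⟨p, hp, h1, h2⟩ := this
    exact (Finset.sum_lt_sum (fun q hq => (hc q hq).1 hxy.le)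
      ⟨p, hp, (hc p hp).2.2 x y hxy h1 h2⟩).ne he
  refine ⟨fun x => ∑ p ∈ t, c p x, t.card * m + 1, hmono, ?_, ?_⟩
  · intro x
    have := Finset.sum_le_card_nsmul t (fun p => c p x) m (fun p hp => (hc p hp).2.1 x)
    simp only [smul_eq_mul] at this
    exact Nat.lt_succ_of_le this
  · intro x y he
    rcases lt_trichotomy x y with h | h | h
    · exact key x y h he
    · simpa [h] using hε
    · rw [dist_comm]; exact key y x h he.symm

lemma covDim_of_snake {M : Type*} [MetricSpace M] [CompactSpace M] [LinearOrder M] (m : ℕ)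
    (h : ∀ x y : M, x ≠ y →
      ∃ ε > 0, ¬ HasSnake (fun a b : M => a < b) (ball x ε) (ball y ε) (m + 1)) :
    CovDimLE M ((m : ℤ) + 1) := by
  classical
  intro 𝒰 hfin hopen hcov
  rcases isEmpty_or_nonempty M with hM | ⟨⟨x₀⟩⟩
  · exact ⟨∅, finite_empty, by simp, by ext x; exact (hM.false x).elim, by simp,
      fun x => (hM.false x).elim⟩
  obtain ⟨δ, hδ, hleb⟩ := lebesgue_number_lemma_of_metric_sUnion (isCompact_univ (X := M)) hopen
    hcov.ge
  obtain ⟨c, B, hmono, hB, hsmall⟩ := exists_label (m + 1) h (δ / 2) (by positivity)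
  let F : ℕ → Set M := fun i => closure (c ⁻¹' {i})
  let S : M → Finset ℕ := fun x => (Finset.range B).filter (fun i => x ∈ F i)
  have hS : ∀ x i, i ∈ S x ↔ i < B ∧ x ∈ F i := by
    intro x i; simp [S]
  have hsub : ∀ t : Finset ℕ, t.card = m + 2 → (⋂ i ∈ t, F i).Subsingleton := by
    intro t ht x hx y hy
    by_contra hxy
    obtain ⟨ε, hε, hs⟩ := h x y hxy
    apply hs
    have hx' : ∀ i ∈ t, ∃ z, c z = i ∧ z ∈ ball x ε := by
      intro i hi
      obtain ⟨z, hz, hd⟩ := Metric.mem_closure_iff.1 (mem_iInter₂.1 hx i hi) ε hε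
      exact ⟨z, hz, by rwa [mem_ball']⟩
    have hy' : ∀ i ∈ t, ∃ z, c z = i ∧ z ∈ ball y ε := by
      intro i hi
      obtain ⟨z, hz, hd⟩ := Metric.mem_closure_iff.1 (mem_iInter₂.1 hy i hi) ε hε
      exact ⟨z, hz, by rwa [mem_ball']⟩
    let e := t.orderEmbOfFin (k := m + 1 + 1) ht
    have he : ∀ j, e j ∈ t := fun j => Finset.orderEmbOfFin_mem t ht j
    have ha : ∀ j : Fin (m + 1 + 1), ∃ z, c z = e j ∧ (Even (j : ℕ) → z ∈ ball x ε) ∧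
        (Odd (j : ℕ) → z ∈ ball y ε) := by
      intro j
      rcases Nat.even_or_odd (j : ℕ) with hj | hj
      · obtain ⟨z, hz, hb⟩ := hx' _ (he j)
        exact ⟨z, hz, fun _ => hb, fun h => absurd hj (Nat.not_even_iff_odd.2 h)⟩
      · obtain ⟨z, hz, hb⟩ := hy' _ (he j)
        exact ⟨z, hz, fun h => absurd h (Nat.not_even_iff_odd.2 hj), fun _ => hb⟩
    choose a ha1 ha2 ha3 using ha
    refine ⟨a, fun i j hij => ?_, ha2, ha3⟩
    apply hmono.reflect_lt
    rw [ha1, ha1]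
    exact e.strictMono hij
  have hfin' : {x | m + 2 ≤ (S x).card}.Finite := by
    refine Set.Finite.subset (s := ⋃ t ∈ (Finset.range B).powersetCard (m + 2), ⋂ i ∈ t, F i) ?_ ?_
    · refine Set.Finite.biUnion (Finset.finite_toSet _) fun t ht => ?_
      exact (hsub t (Finset.mem_powersetCard.1 ht).2).finite
    · intro x hx
      obtain ⟨t, ht, htc⟩ := Finset.exists_subset_card_eq hx
      refine mem_iUnion₂.2 ⟨t, Finset.mem_powersetCard.2 ⟨fun i hi => ?_, htc⟩, ?_⟩
      · exact Finset.mem_range.2 ((hS x i).1 (ht hi)).1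
      · exact mem_iInter₂.2 fun i hi => ((hS x i).1 (ht hi)).2
  have hFU : ∀ i < B, ∃ U ∈ 𝒰, F i ⊆ U := by
    intro i _
    rcases (c ⁻¹' {i}).eq_empty_or_nonempty with he | ⟨z, hz⟩
    · obtain ⟨U, hU, -⟩ := hleb x₀ trivial
      exact ⟨U, hU, by simp [F, he]⟩
    · obtain ⟨U, hU, hb⟩ := hleb z trivial
      refine ⟨U, hU, subset_trans ?_ hb⟩
      refine subset_trans (closure_minimal (t := closedBall z (δ / 2)) ?_ isClosed_closedBall)
        (closedBall_subset_ball (by linarith))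
      intro w hw
      exact (hsmall w z (by rw [show c w = i from hw, show c z = i from hz])).le
  obtain ⟨𝒱, h1, h2, h3, h4, h5⟩ := level_cover 𝒰 hopen hcov B m F (fun i => isClosed_closure) hFU
    S hS hfin' (m + 1) le_rfl
  refine ⟨𝒱, h1, h2, ?_, h3, fun x => by exact_mod_cast h5 x⟩
  refine eq_univ_of_forall fun x => h4 x ?_
  have : 0 < (S x).card := Finset.card_pos.2 ⟨c x, (hS x _).2 ⟨hB x, subset_closure rfl⟩⟩
  omega

lemma backward {M : Type*} [MetricSpace M] [CompactSpace M] (T : M → M → Prop)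
    (hT : IsStrictTotalOrder M T) (hs : snakeNumSpace T < ⊤) : ∃ n : ℤ, CovDimLE M n := by
  classical
  obtain ⟨m, hm⟩ := ENat.ne_top_iff_exists.1 hs.ne
  let : LinearOrder M := linearOrderOfSTO T
  refine ⟨(m : ℤ) + 1, covDim_of_snake m fun x y hxy => ?_⟩
  by_contra hcon
  push Not at hcon
  have h1 : ((m + 1 : ℕ) : ℕ∞) ≤ snakeNum T x y :=
    le_iSup₂_of_le (f := fun (s : ℕ) (_ : s ∈ {s : ℕ | ∀ ε : ℝ, 0 < ε →
      HasSnake T (ball x ε) (ball y ε) s}) => (s : ℕ∞)) (m + 1) hcon le_rfl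
  have h2 : snakeNum T x y ≤ snakeNumSpace T :=
    le_iSup_of_le x (le_iSup_of_le y (le_iSup_of_le hxy le_rfl))
  have := h1.trans h2
  rw [← hm] at this
  have : m + 1 ≤ m := by exact_mod_cast this
  omega

/-- finite open cover of multiplicity at most `N`. -/
def GoodCov {M : Type*} [TopologicalSpace M] (N : ℕ) (𝒱 : Set (Set M)) : Prop :=
  𝒱.Finite ∧ (∀ V ∈ 𝒱, IsOpen V) ∧ ⋃₀ 𝒱 = Set.univ ∧ ∀ x : M, {V ∈ 𝒱 | x ∈ V}.ncard ≤ N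

lemma refine_step {M : Type*} [MetricSpace M] [CompactSpace M] (n : ℤ) (h : CovDimLE M n)
    (𝒰 : Set (Set M)) (hU : ∀ U ∈ 𝒰, IsOpen U) (hcov : ⋃₀ 𝒰 = univ) (r : ℝ) (hr : 0 < r) :
    ∃ 𝒱 : Set (Set M), GoodCov (n + 1).toNat 𝒱 ∧ (∀ V ∈ 𝒱, ∃ U ∈ 𝒰, closure V ⊆ U) ∧
      ∀ V ∈ 𝒱, ∃ z, V ⊆ ball z r := by
  obtain ⟨δ, hδ, hleb⟩ := lebesgue_number_lemma_of_metric_sUnion (isCompact_univ (X := M)) hU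
    hcov.ge
  let ρ := min r (δ / 2)
  have hρ : 0 < ρ := by positivity
  obtain ⟨t, ht⟩ := (isCompact_univ (X := M)).elim_nhds_subcover (fun x => ball x ρ)
    (fun x _ => ball_mem_nhds x hρ)
  obtain ⟨𝒱, h1, h2, h3, h4, h5⟩ := h ((fun x => ball x ρ) '' t) (t.finite_toSet.image _)
    (by rintro _ ⟨x, -, rfl⟩; exact isOpen_ball)
    (by
      rw [sUnion_image]
      exact eq_univ_of_univ_subset ht.2)
  refine ⟨𝒱, ⟨h1, h2, h3, fun x => ?_⟩, ?_, ?_⟩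
  · have := h5 x
    omega
  · intro V hV
    obtain ⟨_, ⟨z, -, rfl⟩, hz⟩ := h4 V hV
    obtain ⟨U, hU, hb⟩ := hleb z trivial
    refine ⟨U, hU, subset_trans ?_ hb⟩
    refine subset_trans (closure_minimal (hz.trans ball_subset_closedBall) isClosed_closedBall)
      (closedBall_subset_ball ?_)
    have := min_le_right r (δ / 2)
    change min r (δ / 2) < δ
    linarith
  · intro V hV
    obtain ⟨_, ⟨z, -, rfl⟩, hz⟩ := h4 V hV
    exact ⟨z, hz.trans (ball_subset_ball (min_le_left _ _))⟩

lemma exists_covers {M : Type*} [MetricSpace M] [CompactSpace M] (n : ℤ) (h : CovDimLE M n) :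
    ∃ 𝒱 : ℕ → Set (Set M), (∀ k, GoodCov (n + 1).toNat (𝒱 k)) ∧
      (∀ k, ∀ w ∈ 𝒱 (k + 1), ∃ p ∈ 𝒱 k, closure w ⊆ p) ∧
      ∀ k, ∀ w ∈ 𝒱 k, ∃ z, w ⊆ ball z (1 / ((k : ℝ) + 1)) := by
  have step : ∀ (k : ℕ) (𝒰 : {𝒰 : Set (Set M) // (∀ U ∈ 𝒰, IsOpen U) ∧ ⋃₀ 𝒰 = univ}),
      ∃ 𝒱 : {𝒰 : Set (Set M) // (∀ U ∈ 𝒰, IsOpen U) ∧ ⋃₀ 𝒰 = univ},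
        GoodCov (n + 1).toNat 𝒱.1 ∧ (∀ V ∈ 𝒱.1, ∃ U ∈ 𝒰.1, closure V ⊆ U) ∧
        ∀ V ∈ 𝒱.1, ∃ z, V ⊆ ball z (1 / ((k : ℝ) + 1)) := by
    intro k 𝒰
    obtain ⟨𝒱, h1, h2, h3⟩ := refine_step n h 𝒰.1 𝒰.2.1 𝒰.2.2 (1 / ((k : ℝ) + 1)) (by positivity)
    exact ⟨⟨𝒱, h1.2.1, h1.2.2.1⟩, h1, h2, h3⟩
  choose nxt g1 g2 g3 using step
  let W : ℕ → {𝒰 : Set (Set M) // (∀ U ∈ 𝒰, IsOpen U) ∧ ⋃₀ 𝒰 = univ} := fun k =>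
    Nat.rec (nxt 0 ⟨{univ}, by simp, by simp⟩) (fun k 𝒰 => nxt (k + 1) 𝒰) k
  refine ⟨fun k => (W k).1, ?_, ?_, ?_⟩
  · rintro (_ | k)
    exacts [g1 _ _, g1 _ _]
  · intro k
    exact g2 (k + 1) (W k)
  · rintro (_ | k)
    exacts [g3 _ _, g3 _ _]


/-- threads through finite sets of an inverse sequence. -/
lemma exists_thread_set {α : Type*} (A : ℕ → Set α) (hfin : ∀ k, (A k).Finite)
    (hne : ∀ k, (A k).Nonempty) (π : ℕ → α → α) (hπ : ∀ k, ∀ a ∈ A (k + 1), π k a ∈ A k) :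
    ∃ f : ℕ → α, ∀ k, f k ∈ A k ∧ π k (f (k + 1)) = f k := by
  have : ∀ k, Finite (A k) := hfin
  have : ∀ k, Nonempty (A k) := fun k => (hne k).to_subtype
  let p : ∀ k, A (k + 1) → A k := fun k a => ⟨π k a, hπ k a a.2⟩
  let P : ∀ {i j : ℕ}, i ≤ j → A j → A i := fun {i j} hij =>
    Nat.leRec (motive := fun j _ => A j → A i) id (fun k _ g => g ∘ p k) hij
  have Psucc : ∀ {i j : ℕ} (hij : i ≤ j) (a : A (j + 1)), P (hij.trans (Nat.le_succ j)) a =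
      P hij (p j a) := by
    intro i j hij a
    simp only [P]
    rw [Nat.leRec_succ (h1 := hij)]
    rfl
  have Prefl : ∀ {i : ℕ} (a : A i), P le_rfl a = a := by
    intro i a
    simp only [P]
    rw [Nat.leRec_self]
    rfl
  obtain ⟨f, hf⟩ := exists_seq_forall_proj_of_forall_finite (α := fun k => A k) P
    (fun i a => Prefl a)
    (by
      intro i j k hij hjk
      induction k, hjk using Nat.le_induction with
      | base => intro a; rw [Prefl]
      | succ k hjk ih =>
        intro a
        rw [Psucc hjk, ih, ← Psucc (hij.trans hjk)])
    (fun i a => Set.toFinite _)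
  refine ⟨fun k => f k, fun k => ⟨(f k).2, ?_⟩⟩
  have h1 := hf (Nat.le_succ k)
  have h2 := Psucc (le_refl k) (f (k + 1))
  rw [Prefl] at h2
  have h3 : p k (f (k + 1)) = f k := h2.symm.trans h1
  exact congrArg Subtype.val h3

lemma forward {M : Type*} [MetricSpace M] [CompactSpace M] (n : ℤ) (h : CovDimLE M n) :
    ∃ T : M → M → Prop, IsStrictTotalOrder M T ∧ snakeNumSpace T < ⊤ := by
  classical
  obtain ⟨𝒱, hgood, hpar, hmesh⟩ := exists_covers n h
  set N := (n + 1).toNat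
  have hpar' : ∀ k w, ∃ p, w ∈ 𝒱 (k + 1) → p ∈ 𝒱 k ∧ closure w ⊆ p := by
    intro k w
    by_cases hw : w ∈ 𝒱 (k + 1)
    · obtain ⟨p, hp⟩ := hpar k w hw
      exact ⟨p, fun _ => hp⟩
    · exact ⟨∅, fun h => absurd h hw⟩
  choose π hπ using hpar'
  have hthr : ∀ x : M, ∃ f : ℕ → Set M, ∀ k, f k ∈ {w ∈ 𝒱 k | x ∈ w} ∧ π k (f (k + 1)) = f k := by
    intro x
    refine exists_thread_set (fun k => {w ∈ 𝒱 k | x ∈ w})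
      (fun k => (hgood k).1.subset fun _ h => h.1) (fun k => ?_) π ?_
    · have : x ∈ ⋃₀ 𝒱 k := by rw [(hgood k).2.2.1]; trivial
      obtain ⟨w, hw, hx⟩ := this
      exact ⟨w, hw, hx⟩
    · rintro k w ⟨hw, hx⟩
      exact ⟨(hπ k w hw).1, (hπ k w hw).2 (subset_closure hx)⟩
  choose F hF using hthr
  have hFV : ∀ x k, F x k ∈ 𝒱 k := fun x k => (hF x k).1.1
  have hFx : ∀ x k, x ∈ F x k := fun x k => (hF x k).1.2
  have hFπ : ∀ x k, π k (F x (k + 1)) = F x k := fun x k => (hF x k).2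
  have hdist : ∀ x y k, F x k = F y k → dist x y < 2 / ((k : ℝ) + 1) := by
    intro x y k hxy
    obtain ⟨z, hz⟩ := hmesh k _ (hFV x k)
    have h1 := mem_ball.1 (hz (hFx x k))
    have h2 := mem_ball'.1 (hz (hxy ▸ hFx y k))
    have := dist_triangle x z y
    have e : 2 / ((k : ℝ) + 1) = 1 / ((k : ℝ) + 1) + 1 / ((k : ℝ) + 1) := by ring
    linarith
  have hscale : ∀ x y : M, x ≠ y → ∃ k : ℕ, 2 / ((k : ℝ) + 1) < dist x y / 3 := by
    intro x y hxy
    have hd : 0 < dist x y := dist_pos.2 hxy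
    obtain ⟨k, hk⟩ := exists_nat_one_div_lt (show 0 < dist x y / 6 by positivity)
    refine ⟨k, ?_⟩
    have e : 2 / ((k : ℝ) + 1) = 2 * (1 / ((k : ℝ) + 1)) := by ring
    linarith
  have hinj : Function.Injective F := by
    intro x y hxy
    by_contra hne
    obtain ⟨k, hk⟩ := hscale x y hne
    have := hdist x y k (by rw [hxy])
    have hd : 0 < dist x y := dist_pos.2 hne
    linarith
  have hdown : ∀ x y k i, i ≤ k → F x k = F y k → F x i = F y i := by
    intro x y k i hik
    induction k, hik using Nat.le_induction with
    | base => exact id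
    | succ k _ ih =>
      intro hh
      apply ih
      rw [← hFπ x, ← hFπ y, hh]
  let ψ : Set M ↪ Cardinal := embeddingToCardinal
  let G : M → Lex (ℕ → Cardinal) := fun x => toLex (fun k => ψ (F x k))
  have hG : Function.Injective G := fun x y hxy =>
    hinj (funext fun k => ψ.injective (congrFun (toLex.injective hxy) k))
  let LO : LinearOrder M := LinearOrder.lift' G hG
  have hlt : ∀ x y : M, x < y ↔ ∃ k, (∀ i < k, F x i = F y i) ∧ ψ (F x k) < ψ (F y k) := by
    intro x y
    have h0 : x < y ↔ ∃ k, (∀ i < k, ψ (F x i) = ψ (F y i)) ∧ ψ (F x k) < ψ (F y k) := Iff.rfl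
    simpa only [ψ.injective.eq_iff] using h0
  have hconv : ∀ x y z k, x < y → y < z → F x k = F z k → F x k = F y k := by
    intro x y z k hxy hyz hxz
    have hxz' := fun i hi => hdown x z k i hi hxz
    obtain ⟨p, hp1, hp2⟩ := (hlt x y).1 hxy
    obtain ⟨q, hq1, hq2⟩ := (hlt y z).1 hyz
    rcases Nat.lt_or_ge k p with hkp | hkp
    · exact hp1 k hkp
    exfalso
    rcases lt_trichotomy p q with hpq | hpq | hpq
    · rw [hxz' p hkp, hq1 p hpq] at hp2
      exact lt_irrefl _ hp2
    · subst hpq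
      rw [hxz' p hkp] at hp2
      exact lt_asymm hp2 hq2
    · rw [← hp1 q hpq, hxz' q (by omega)] at hq2
      exact lt_irrefl _ hq2
  have hnear : ∀ x k, ∀ᶠ z in nhds x, x ∈ F z k := by
    intro x k
    have hcl : IsClosed (⋃ w ∈ {w ∈ 𝒱 (k + 1) | x ∉ closure w}, closure w) :=
      Set.Finite.isClosed_biUnion ((hgood (k + 1)).1.subset fun _ h => h.1)
        fun _ _ => isClosed_closure
    have hx : x ∈ (⋃ w ∈ {w ∈ 𝒱 (k + 1) | x ∉ closure w}, closure w)ᶜ := by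
      intro hx
      obtain ⟨w, hw, hxw⟩ := mem_iUnion₂.1 hx
      exact hw.2 hxw
    filter_upwards [hcl.isOpen_compl.mem_nhds hx] with z hz
    rw [← hFπ z k]
    apply (hπ k _ (hFV z (k + 1))).2
    by_contra hcon
    exact hz (mem_iUnion₂.2 ⟨F z (k + 1), ⟨hFV z (k + 1), hcon⟩, subset_closure (hFx z (k + 1))⟩)
  refine ⟨fun x y => x < y, inferInstance, ?_⟩
  refine lt_of_le_of_lt (b := ((2 * N : ℕ) : ℕ∞)) ?_ (ENat.coe_lt_top _)
  refine iSup_le fun x => iSup_le fun y => iSup_le fun hxy => iSup₂_le fun s hs => ?_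
  obtain ⟨k, hk⟩ := hscale x y hxy
  obtain ⟨e, he, hball⟩ := Metric.eventually_nhds_iff.1 (hnear x k)
  have hd : 0 < dist x y := dist_pos.2 hxy
  obtain ⟨a, ha1, ha2, ha3⟩ := hs (min e (dist x y / 3)) (by positivity)
  have hle : s / 2 + 1 ≤ N := by
    let g : Fin (s / 2 + 1) → Fin (s + 1) := fun i => ⟨2 * i, by omega⟩
    have hgx : ∀ i, a (g i) ∈ ball x (min e (dist x y / 3)) := fun i =>
      ha2 (g i) (even_two_mul _)
    have hlt' : ∀ i j : Fin (s / 2 + 1), i < j → F (a (g i)) k ≠ F (a (g j)) k := by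
      intro i j hij heq
      have hij' : (i : ℕ) < j := hij
      let o : Fin (s + 1) := ⟨2 * i + 1, by omega⟩
      have hoy : a o ∈ ball y (min e (dist x y / 3)) := ha3 o (odd_two_mul_add_one _)
      have h1 := hconv (a (g i)) (a o) (a (g j)) k
        (ha1 _ _ (by change 2 * (i : ℕ) < 2 * i + 1; omega))
        (ha1 _ _ (by change 2 * (i : ℕ) + 1 < 2 * j; omega)) heq
      have h2 := hdist _ _ _ h1
      have h3 := (mem_ball'.1 (hgx i)).trans_le (min_le_right _ _)
      have h4 := (mem_ball.1 hoy).trans_le (min_le_right _ _)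
      have h5 := dist_triangle4 x (a (g i)) (a o) y
      linarith
    have hinj' : Function.Injective (fun i : Fin (s / 2 + 1) => F (a (g i)) k) := by
      intro i j hij
      rcases lt_trichotomy i j with h | h | h
      · exact absurd hij (hlt' i j h)
      · exact h
      · exact absurd hij.symm (hlt' j i h)
    have hsub : range (fun i : Fin (s / 2 + 1) => F (a (g i)) k) ⊆ {V ∈ 𝒱 k | x ∈ V} := by
      rintro _ ⟨i, rfl⟩
      exact ⟨hFV _ _, hball ((mem_ball.1 (hgx i)).trans_le (min_le_left _ _))⟩
    have h1 := Set.ncard_le_ncard hsub ((hgood k).1.subset fun _ h => h.1)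
    have h2 : (range (fun i : Fin (s / 2 + 1) => F (a (g i)) k)).ncard = s / 2 + 1 := by
      rw [← Set.image_univ, Set.ncard_image_of_injective _ hinj', Set.ncard_univ, Nat.card_fin]
    have h3 := (hgood k).2.2.2 x
    omega
  exact_mod_cast (by omega : s ≤ 2 * N)

/-- **Theorem (main).** For a compact metric space `M`, the covering dimension of `M`
is finite if and only if there exists a total order `T` on `M` with `Snake(M,T) < ∞`. -/
theorem covDim_finite_iff_exists_order_snake_finite
    {M : Type*} [MetricSpace M] [CompactSpace M] :
    (∃ n : ℤ, CovDimLE M n) ↔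
      ∃ T : M → M → Prop, IsStrictTotalOrder M T ∧ snakeNumSpace T < ⊤ := by
  constructor
  · rintro ⟨n, h⟩
    exact forward n h
  · rintro ⟨T, hT, hs⟩
    exact backward T hT hs
end

section
/- Let (M,T) be an ordered compact metric space (M a compact metric space, T a total order on M) such that Snake(M,T) ≤ s. Then the Lebesgue covering dimension of M satisfies dim M ≤ s. -/
open Metric Set

section SnakeHelpers

universe u

open Filter Topology

theorem hasSnake_mono {M : Type*} {T : M → M → Prop} {U V U' V' : Set M} {n : ℕ}
    (hU : U ⊆ U') (hV : V ⊆ V') (h : HasSnake T U V n) : HasSnake T U' V' n := by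
  obtain ⟨a, h1, h2, h3⟩ := h
  exact ⟨a, h1, fun i hi => hU (h2 i hi), fun i hi => hV (h3 i hi)⟩

theorem hasSnake_snoc {M : Type*} {T : M → M → Prop} {U V U' V' : Set M} {n : ℕ} {b : M}
    (hU : U ⊆ U') (hV : V ⊆ V') (h : HasSnake T U V n)
    (hUb : ∀ w ∈ U, T w b) (hVb : ∀ w ∈ V, T w b)
    (he : Even (n + 1) → b ∈ U') (ho : Odd (n + 1) → b ∈ V') : HasSnake T U' V' (n + 1) := by
  obtain ⟨a, h1, h2, h3⟩ := h
  have hab : ∀ i, T (a i) b := by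
    intro i
    rcases Nat.even_or_odd (i : ℕ) with hi | hi
    · exact hUb _ (h2 i hi)
    · exact hVb _ (h3 i hi)
  refine ⟨Fin.snoc (α := fun _ => M) a b, ?_, ?_, ?_⟩
  · intro i j hij
    induction j using Fin.lastCases with
    | last =>
      induction i using Fin.lastCases with
      | last => exact absurd hij (lt_irrefl _)
      | cast i => simpa using hab i
    | cast j =>
      induction i using Fin.lastCases with
      | last => exact absurd hij (not_lt.2 (Fin.le_last _))
      | cast i => simpa using h1 i j (by simpa using hij)
  · intro i hi
    induction i using Fin.lastCases with
    | last => simpa using he (by simpa using hi)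
    | cast i => simpa using hU (h2 i (by simpa using hi))
  · intro i hi
    induction i using Fin.lastCases with
    | last => simpa using ho (by simpa using hi)
    | cast i => simpa using hV (h3 i (by simpa using hi))

/-- If the last point cannot be `z`, the snake is strictly below `z`. -/
theorem hasSnake_strict {M : Type*} {T : M → M → Prop} (hT : IsStrictTotalOrder M T)
    {U V : Set M} {n : ℕ} {z : M}
    (h : HasSnake T (U ∩ {w | ¬ T z w}) (V ∩ {w | ¬ T z w}) n)
    (he : Even n → z ∉ U) (ho : Odd n → z ∉ V) :
    HasSnake T (U ∩ {w | T w z}) (V ∩ {w | T w z}) n := by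
  obtain ⟨a, h1, h2, h3⟩ := h
  have hle : ∀ i, ¬ T z (a i) := by
    intro i
    rcases Nat.even_or_odd (i : ℕ) with hi | hi
    · exact (h2 i hi).2
    · exact (h3 i hi).2
  have hne : a (Fin.last n) ≠ z := by
    rcases Nat.even_or_odd n with hi | hi
    · intro h; exact he hi (h ▸ (h2 (Fin.last n) (by simpa using hi)).1)
    · intro h; exact ho hi (h ▸ (h3 (Fin.last n) (by simpa using hi)).1)
  have hlast : T (a (Fin.last n)) z := by
    by_contra hc
    exact hne (hT.trichotomous _ _ hc (hle _))
  have hlt : ∀ i, T (a i) z := by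
    intro i
    rcases (Fin.le_last i).eq_or_lt with hi | hi
    · rw [hi]; exact hlast
    · exact hT.trans _ _ _ (h1 _ _ hi) hlast
  exact ⟨a, h1, fun i hi => ⟨(h2 i hi).1, hlt i⟩, fun i hi => ⟨(h3 i hi).1, hlt i⟩⟩

/-- Separation of points of `U` and `V` by the cuts given by snakes. -/
theorem snake_sep {M : Type*} {T : M → M → Prop} (hT : IsStrictTotalOrder M T)
    {U V : Set M} {N : ℕ} (hd : Disjoint U V) (hN : ¬ HasSnake T U V N) {x y : M} (hxy : T x y)
    (h : (x ∈ U ∧ y ∈ V) ∨ (x ∈ V ∧ y ∈ U)) :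
    ∃ j ≤ N, ¬ HasSnake T (U ∩ {w | ¬ T x w}) (V ∩ {w | ¬ T x w}) j ∧
      HasSnake T (U ∩ {w | ¬ T y w}) (V ∩ {w | ¬ T y w}) j := by
  by_contra! hc
  have hc' : ∀ j ≤ N, HasSnake T (U ∩ {w | ¬ T y w}) (V ∩ {w | ¬ T y w}) j →
      HasSnake T (U ∩ {w | ¬ T x w}) (V ∩ {w | ¬ T x w}) j := by
    intro j hj h1
    by_contra h2
    exact hc j hj h2 h1
  have hlexy : ∀ w, ¬ T x w → T w y := by
    intro w hw
    by_cases hwx : T w x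
    · exact hT.trans _ _ _ hwx hxy
    · rwa [hT.trichotomous _ _ hwx hw]
  have hyx : ¬ T y x := fun h => hT.irrefl x (hT.trans _ _ _ hxy h)
  have key : ∀ j ≤ N, HasSnake T (U ∩ {w | ¬ T x w}) (V ∩ {w | ¬ T x w}) j := by
    intro j
    induction j with
    | zero =>
      intro hj
      apply hc' 0 hj
      rcases h with ⟨hx, hy⟩ | ⟨hx, hy⟩
      · exact ⟨fun _ => x, fun i j hij => by omega, fun i _ => ⟨hx, hyx⟩,
          fun i hi => by simp at hi⟩
      · exact ⟨fun _ => y, fun i j hij => by omega, fun i _ => ⟨hy, hT.irrefl y⟩,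
          fun i hi => by simp at hi⟩
    | succ j ih =>
      intro hj
      have hs := ih (by omega)
      by_cases hyy : (Even (j + 1) → y ∈ U) ∧ (Odd (j + 1) → y ∈ V)
      · apply hc' _ hj
        refine hasSnake_snoc (b := y) ?_ ?_ hs ?_ ?_ ?_ ?_
        · rintro w ⟨hw, hw'⟩
          exact ⟨hw, fun h => hT.irrefl _ (hT.trans _ _ _ (hlexy w hw') h)⟩
        · rintro w ⟨hw, hw'⟩
          exact ⟨hw, fun h => hT.irrefl _ (hT.trans _ _ _ (hlexy w hw') h)⟩
        · rintro w ⟨hw, hw'⟩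
          exact hlexy w hw'
        · rintro w ⟨hw, hw'⟩
          exact hlexy w hw'
        · exact fun h => ⟨hyy.1 h, hT.irrefl y⟩
        · exact fun h => ⟨hyy.2 h, hT.irrefl y⟩
      · have hdx : ¬ (x ∈ U ∧ x ∈ V) := fun hh => Set.disjoint_left.1 hd hh.1 hh.2
        have hxx : (Even (j + 1) → x ∈ U) ∧ (Odd (j + 1) → x ∈ V) := by
          have := Nat.not_even_iff_odd (n := j + 1)
          tauto
        have hst := hasSnake_strict hT hs
          (by
            intro he hx
            exact hdx ⟨hx, hxx.2 he.add_one⟩)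
          (by
            intro ho hx
            exact hdx ⟨hxx.1 ho.add_one, hx⟩)
        refine hasSnake_snoc (b := x) ?_ ?_ hst ?_ ?_ ?_ ?_
        · rintro w ⟨hw, hw'⟩
          exact ⟨hw, fun h => hT.irrefl _ (hT.trans _ _ _ hw' h)⟩
        · rintro w ⟨hw, hw'⟩
          exact ⟨hw, fun h => hT.irrefl _ (hT.trans _ _ _ hw' h)⟩
        · exact fun w hw => hw.2
        · exact fun w hw => hw.2
        · exact fun h => ⟨hxx.1 h, hT.irrefl x⟩
        · exact fun h => ⟨hxx.2 h, hT.irrefl x⟩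
  exact hN (hasSnake_mono inter_subset_left inter_subset_left (key N le_rfl))

/-- Lower sets for `T`. -/
def IsLowerFor {M : Type*} (T : M → M → Prop) (L : Set M) : Prop :=
  ∀ x y, T x y → y ∈ L → x ∈ L

theorem exists_cuts_pair {M : Type*} {T : M → M → Prop} (hT : IsStrictTotalOrder M T)
    {U V : Set M} {N : ℕ} (hd : Disjoint U V) (hN : ¬ HasSnake T U V N) :
    ∃ 𝓛 : Set (Set M), 𝓛.Finite ∧ (∀ L ∈ 𝓛, IsLowerFor T L) ∧
      ∀ x ∈ U, ∀ y ∈ V, ∃ L ∈ 𝓛, ¬ (x ∈ L ↔ y ∈ L) := by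
  refine ⟨(fun j => {z | ¬ HasSnake T (U ∩ {w | ¬ T z w}) (V ∩ {w | ¬ T z w}) j}) '' Set.Iic N,
    (Set.finite_Iic N).image _, ?_, ?_⟩
  · rintro _ ⟨j, _, rfl⟩ x y hxy hy hx
    apply hy
    have : {w | ¬ T x w} ⊆ {w | ¬ T y w} := fun w hw h => hw (hT.trans _ _ _ hxy h)
    exact hasSnake_mono (inter_subset_inter_right _ this) (inter_subset_inter_right _ this) hx
  · intro x hx y hy
    have hne : x ≠ y := by rintro rfl; exact Set.disjoint_left.1 hd hx hy
    by_cases hxy : T x y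
    · obtain ⟨j, hj, h1, h2⟩ := snake_sep hT hd hN hxy (Or.inl ⟨hx, hy⟩)
      refine ⟨_, ⟨j, hj, rfl⟩, ?_⟩
      simp only [mem_ofPred_eq]
      tauto
    · have hyx : T y x := by
        by_contra hc
        exact hne (hT.trichotomous _ _ hxy hc)
      obtain ⟨j, hj, h1, h2⟩ := snake_sep hT hd hN hyx (Or.inr ⟨hy, hx⟩)
      refine ⟨_, ⟨j, hj, rfl⟩, ?_⟩
      simp only [mem_ofPred_eq]
      tauto

/-- Local absence of snakes of length `k`. -/
def NoSnake {M : Type*} [MetricSpace M] (T : M → M → Prop) (k : ℕ) : Prop :=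
  ∀ x y : M, x ≠ y → ∃ ε : ℝ, 0 < ε ∧ ¬ HasSnake T (ball x ε) (ball y ε) k

theorem exists_cuts {M : Type*} [MetricSpace M] [CompactSpace M] {T : M → M → Prop}
    (hT : IsStrictTotalOrder M T) {k : ℕ} (hk : NoSnake T k) {δ : ℝ} (hδ : 0 < δ) :
    ∃ 𝓛 : Set (Set M), 𝓛.Finite ∧ (∀ L ∈ 𝓛, IsLowerFor T L) ∧
      ∀ x y, δ ≤ dist x y → ∃ L ∈ 𝓛, ¬ (x ∈ L ↔ y ∈ L) := by
  have hK : IsCompact {p : M × M | δ ≤ dist p.1 p.2} :=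
    (isClosed_le continuous_const (continuous_fst.dist continuous_snd)).isCompact
  have hloc : ∀ p ∈ {p : M × M | δ ≤ dist p.1 p.2}, ∃ W ∈ 𝓝 p, ∃ 𝓛 : Set (Set M), 𝓛.Finite ∧
      (∀ L ∈ 𝓛, IsLowerFor T L) ∧ ∀ q ∈ W, ∃ L ∈ 𝓛, ¬ (q.1 ∈ L ↔ q.2 ∈ L) := by
    rintro ⟨x, y⟩ hp
    have hp' : δ ≤ dist x y := hp
    obtain ⟨ε, hε, hn⟩ := hk x y (dist_pos.1 (hδ.trans_le hp'))
    set r := min ε (δ / 2) with hr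
    have hr0 : 0 < r := lt_min hε (by linarith)
    have hd : Disjoint (ball x r) (ball y r) := by
      apply ball_disjoint_ball
      have := min_le_right ε (δ / 2)
      linarith
    have hn' : ¬ HasSnake T (ball x r) (ball y r) k := fun h =>
      hn (hasSnake_mono (ball_subset_ball (min_le_left _ _)) (ball_subset_ball (min_le_left _ _)) h)
    obtain ⟨𝓛, h1, h2, h3⟩ := exists_cuts_pair hT hd hn'
    exact ⟨ball x r ×ˢ ball y r, prod_mem_nhds (ball_mem_nhds _ hr0) (ball_mem_nhds _ hr0),
      𝓛, h1, h2, fun q hq => h3 _ hq.1 _ hq.2⟩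
  choose! W hW 𝓛 h1 h2 h3 using hloc
  obtain ⟨t, ht, htc⟩ := hK.elim_nhds_subcover W hW
  refine ⟨⋃ p ∈ t, 𝓛 p, t.finite_toSet.biUnion fun p hp => h1 p (ht p hp), ?_, ?_⟩
  · intro L hL
    simp only [mem_iUnion] at hL
    obtain ⟨p, hp, hL⟩ := hL
    exact h2 p (ht p hp) L hL
  · intro x y hxy
    have := htc (show (x, y) ∈ {p : M × M | δ ≤ dist p.1 p.2} from hxy)
    simp only [mem_iUnion] at this
    obtain ⟨p, hp, hq⟩ := this
    obtain ⟨L, hL, hh⟩ := h3 p (ht p hp) _ hq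
    refine ⟨L, ?_, hh⟩
    simp only [mem_iUnion]
    exact ⟨p, hp, hL⟩

/-- The new order on the frontier of a lower set. -/
theorem frontier_order {M : Type*} [MetricSpace M] {T : M → M → Prop}
    (hT : IsStrictTotalOrder M T) {k : ℕ} (hk : NoSnake T (k + 1)) {L : Set M}
    (hL : IsLowerFor T L) :
    ∃ T' : frontier L → frontier L → Prop, IsStrictTotalOrder (frontier L) T' ∧ NoSnake T' k := by
  have hcl : ∀ (p : frontier L) (n : ℕ), ∃ q ∈ L, dist (p : M) q < 1 / ((n : ℝ) + 1) := by
    intro p n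
    have hp : (p : M) ∈ closure L := frontier_subset_closure p.2
    exact Metric.mem_closure_iff.1 hp _ (by positivity)
  choose a haL had using hcl
  have hsmall : ∀ (p : frontier L) (ε : ℝ), 0 < ε →
      ∀ᶠ n in (hyperfilter ℕ : Filter ℕ), dist (p : M) (a p n) < ε := by
    intro p ε hε
    have h1 : ∀ᶠ n : ℕ in atTop, 1 / ((n : ℝ) + 1) < ε :=
      tendsto_one_div_add_atTop_nhds_zero_nat.eventually (gt_mem_nhds hε)
    exact (h1.filter_mono Nat.hyperfilter_le_atTop).mono fun n hn => (had p n).trans hn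
  refine ⟨fun p q => ∀ᶠ n in (hyperfilter ℕ : Filter ℕ), T (a p n) (a q n), ?_, ?_⟩
  · refine { trichotomous := ?_, irrefl := ?_, trans := ?_ }
    · intro p q hpq hqp
      by_contra hne
      have hne' : (p : M) ≠ q := fun h => hne (Subtype.ext h)
      have hd := dist_pos.2 hne'
      have h1 := hsmall p (dist (p : M) q / 2) (by linarith)
      have h2 := hsmall q (dist (p : M) q / 2) (by linarith)
      have : ∀ᶠ n in (hyperfilter ℕ : Filter ℕ), T (a p n) (a q n) ∨ T (a q n) (a p n) := by
        filter_upwards [h1, h2] with n h1 h2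
        by_contra! hc
        have heq := hT.trichotomous _ _ hc.1 hc.2
        rw [← heq] at h2
        have := dist_triangle_right (p : M) q (a p n)
        linarith
      rcases Ultrafilter.eventually_or.1 this with h | h
      · exact hpq h
      · exact hqp h
    · intro p hp
      obtain ⟨n, hn⟩ := hp.exists
      exact hT.irrefl _ hn
    · intro p q r h1 h2
      filter_upwards [h1, h2] with n h1 h2 using hT.trans _ _ _ h1 h2
  · intro x y hxy
    have hne' : (x : M) ≠ y := fun h => hxy (Subtype.ext h)
    obtain ⟨ε, hε, hn⟩ := hk x y hne'
    refine ⟨ε / 2, by linarith, ?_⟩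
    rintro ⟨b, hb1, hb2, hb3⟩
    apply hn
    have e1 : ∀ᶠ n in (hyperfilter ℕ : Filter ℕ), ∀ i, dist (b i : M) (a (b i) n) < ε / 2 :=
      eventually_all.2 fun i => hsmall _ _ (by linarith)
    have e2 : ∀ᶠ n in (hyperfilter ℕ : Filter ℕ), ∀ i j, i < j → T (a (b i) n) (a (b j) n) :=
      eventually_all.2 fun i => eventually_all.2 fun j => eventually_imp_distrib_left.2 (hb1 i j)
    obtain ⟨n, hn1, hn2⟩ := (e1.and e2).exists
    have hs : HasSnake T (ball (x : M) ε ∩ L) (ball (y : M) ε ∩ L) k := by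
      refine ⟨fun i => a (b i) n, hn2, fun i hi => ⟨?_, haL _ _⟩, fun i hi => ⟨?_, haL _ _⟩⟩
      · have h1 : dist (b i : M) x < ε / 2 := hb2 i hi
        have h2 := hn1 i
        have := dist_triangle_left (a (b i) n) (x : M) (b i)
        rw [mem_ball]; linarith
      · have h1 : dist (b i : M) y < ε / 2 := hb3 i hi
        have h2 := hn1 i
        have := dist_triangle_left (a (b i) n) (y : M) (b i)
        rw [mem_ball]; linarith
    have habove : ∀ p : frontier L, ∃ q ∈ ball (p : M) ε, q ∉ L := by
      intro p
      have hp : (p : M) ∈ closure Lᶜ := by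
        have hfr : frontier Lᶜ = frontier L := frontier_compl L
        exact frontier_subset_closure (hfr.symm.subset p.2)
      obtain ⟨q, hq, hd⟩ := Metric.mem_closure_iff.1 hp ε hε
      exact ⟨q, by rwa [mem_ball, dist_comm], hq⟩
    have hlt : ∀ w ∈ L, ∀ q, q ∉ L → T w q := by
      intro w hw q hq
      by_contra hc
      by_cases h : T q w
      · exact hq (hL _ _ h hw)
      · exact hq (hT.trichotomous _ _ hc h ▸ hw)
    rcases Nat.even_or_odd (k + 1) with hp | hp
    · obtain ⟨q, hq, hqL⟩ := habove x
      exact hasSnake_snoc inter_subset_left inter_subset_left hs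
        (fun w hw => hlt w hw.2 q hqL) (fun w hw => hlt w hw.2 q hqL) (fun _ => hq)
        (fun ho => absurd hp (Nat.not_even_iff_odd.2 ho))
    · obtain ⟨q, hq, hqL⟩ := habove y
      exact hasSnake_snoc inter_subset_left inter_subset_left hs
        (fun w hw => hlt w hw.2 q hqL) (fun w hw => hlt w hw.2 q hqL)
        (fun he => absurd he (Nat.not_even_iff_odd.2 hp)) (fun _ => hq)

/-- Every finite open cover shrinks to one whose multiplicity on `A` is at most `k`. -/
def ShrinkOn {M : Type u} [TopologicalSpace M] (A : Set M) (k : ℕ) : Prop :=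
  ∀ (ι : Type u) [Finite ι] (U : ι → Set M), (∀ i, IsOpen (U i)) → (∀ x, ∃ i, x ∈ U i) →
    ∃ W : ι → Set M, (∀ i, IsOpen (W i)) ∧ (∀ x, ∃ i, x ∈ W i) ∧ (∀ i, W i ⊆ U i) ∧
      ∀ x ∈ A, {i | x ∈ W i}.ncard ≤ k

theorem shrinkOn_of_subtype {M : Type u} [TopologicalSpace M] {A : Set M} (hA : IsClosed A) {k : ℕ}
    (h : ShrinkOn (univ : Set A) k) : ShrinkOn A k := by
  intro ι _ U hU hc
  obtain ⟨V, hV, hVc, hVU, hVk⟩ := h ι (fun i => Subtype.val ⁻¹' U i)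
    (fun i => (hU i).preimage continuous_subtype_val) (fun x => hc x)
  have : ∀ i, ∃ O : Set M, IsOpen O ∧ Subtype.val ⁻¹' O = V i := fun i => isOpen_induced_iff.1 (hV i)
  choose O hO hOV using this
  have hOV' : ∀ i (x : A), (x : M) ∈ O i ↔ x ∈ V i := fun i x => by rw [← hOV i]; rfl
  refine ⟨fun i => (O i ∪ Aᶜ) ∩ U i, fun i => ((hO i).union hA.isOpen_compl).inter (hU i), ?_,
    fun i => inter_subset_right, ?_⟩
  · intro x
    by_cases hx : x ∈ A
    · obtain ⟨i, hi⟩ := hVc ⟨x, hx⟩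
      exact ⟨i, Or.inl ((hOV' i ⟨x, hx⟩).2 hi), hVU i hi⟩
    · obtain ⟨i, hi⟩ := hc x
      exact ⟨i, Or.inr hx, hi⟩
  · intro x hx
    refine (Set.ncard_le_ncard ?_ (Set.toFinite _)).trans (hVk ⟨x, hx⟩ (mem_univ _))
    rintro i ⟨h1 | h1, h2⟩
    · exact (hOV' i ⟨x, hx⟩).1 h1
    · exact absurd hx h1

theorem shrinkOn_biUnion {M : Type u} [TopologicalSpace M] {k : ℕ} {α : Type*} {F : α → Set M}
    {S : Set α} (hS : S.Finite) (h : ∀ a ∈ S, ShrinkOn (F a) k) : ShrinkOn (⋃ a ∈ S, F a) k := by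
  induction S, hS using Set.Finite.induction_on with
  | empty =>
    intro ι _ U hU hc
    exact ⟨U, hU, hc, fun i => subset_rfl, by simp⟩
  | @insert a S _ _ ih =>
    intro ι _ U hU hc
    obtain ⟨V, hV, hVc, hVU, hVk⟩ := ih (fun b hb => h b (mem_insert_of_mem _ hb)) ι U hU hc
    obtain ⟨W, hW, hWc, hWV, hWk⟩ := h a (mem_insert _ _) ι V hV hVc
    refine ⟨W, hW, hWc, fun i => (hWV i).trans (hVU i), ?_⟩
    intro x hx
    rw [biUnion_insert] at hx
    rcases hx with hx | hx
    · exact hWk x hx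
    · exact (Set.ncard_le_ncard (fun i hi => hWV i hi) (Set.toFinite _)).trans (hVk x hx)

theorem shrink_main (k : ℕ) : ∀ (M : Type u) [MetricSpace M] [CompactSpace M]
    (T : M → M → Prop), IsStrictTotalOrder M T → NoSnake T (k + 1) →
    ShrinkOn (univ : Set M) (k + 1) := by
  induction k with
  | zero =>
    intro M _ _ T hT hk
    have hsub : ∀ x y : M, x = y := by
      have key : ∀ x y : M, ¬ T x y := by
        intro x y hxy
        have hne : x ≠ y := by rintro rfl; exact hT.irrefl _ hxy
        obtain ⟨ε, hε, hn⟩ := hk x y hne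
        refine hn (hasSnake_snoc (U := {x}) (V := ∅) (n := 0) (b := y) ?_ ?_ ?_ ?_ ?_ ?_ ?_)
        · simpa using hε
        · simp
        · exact ⟨fun _ => x, fun i j hij => by omega, fun i _ => rfl, fun i hi => by simp at hi⟩
        · simpa using hxy
        · simp
        · simp
        · intro _; simpa using hε
      exact fun x y => hT.trichotomous _ _ (key x y) (key y x)
    intro ι _ U hU hc
    rcases isEmpty_or_nonempty M with hM | ⟨⟨x⟩⟩
    · exact ⟨U, hU, hc, fun i => subset_rfl, fun x => hM.elim x⟩
    · obtain ⟨i, hi⟩ := hc x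
      refine ⟨fun j => {y | j = i}, fun j => isOpen_const, fun y => ⟨i, rfl⟩, ?_, ?_⟩
      · rintro j y rfl
        rwa [hsub y x]
      · intro y _
        simp
  | succ k ih =>
    intro M _ _ T hT hk ι _ U hU hc
    obtain ⟨δ, hδ, hleb⟩ := lebesgue_number_lemma_of_metric (isCompact_univ (X := M)) hU
      (fun x _ => mem_iUnion.2 (hc x))
    obtain ⟨𝓛, hfin, hlow, hsep⟩ := exists_cuts hT hk hδ
    set Z : Set M := ⋃ L ∈ 𝓛, frontier L with hZ
    have hZc : IsClosed Z := hfin.isClosed_biUnion fun L _ => isClosed_frontier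
    have hZs : ShrinkOn Z (k + 1) := by
      apply shrinkOn_biUnion hfin
      intro L hL
      apply shrinkOn_of_subtype isClosed_frontier
      obtain ⟨T', hT', hk'⟩ := frontier_order hT hk (hlow L hL)
      haveI : CompactSpace (frontier L) := isCompact_iff_compactSpace.1 isClosed_frontier.isCompact
      exact ih (frontier L) T' hT' hk'
    obtain ⟨W', hW', hWc', hWU', hWk'⟩ := hZs ι U hU hc
    obtain ⟨V, hVc, hV, hVW⟩ := exists_iUnion_eq_closure_subset hW' (fun x => Set.toFinite _)
      (iUnion_eq_univ_iff.2 hWc')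
    set O : Set M := {x | {i | x ∈ closure (V i)}.ncard ≤ k + 1} with hO
    have hOo : IsOpen O := by
      rw [isOpen_iff_mem_nhds]
      intro x hx
      have : ∀ᶠ y in 𝓝 x, ∀ i, y ∈ closure (V i) → x ∈ closure (V i) := by
        refine eventually_all.2 fun i => ?_
        by_cases hxi : x ∈ closure (V i)
        · exact Eventually.of_forall fun _ _ => hxi
        · filter_upwards [isClosed_closure.isOpen_compl.mem_nhds hxi] with y hy h
          exact absurd h hy
      filter_upwards [this] with y hy
      exact (Set.ncard_le_ncard (fun i hi => hy i hi) (Set.toFinite _)).trans hx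
    have hZO : Z ⊆ O := fun x hx =>
      (Set.ncard_le_ncard (fun i hi => hVW i hi) (Set.toFinite _)).trans (hWk' x hx)
    -- the classes
    let σ : M → Set (Set M) := fun x => {L | L ∈ 𝓛 ∧ x ∈ L}
    have hcls : ∀ c : Set.range σ, ∃ i, ∀ x, σ x = c → x ∈ U i := by
      rintro ⟨_, x, rfl⟩
      obtain ⟨i, hi⟩ := hleb x (mem_univ _)
      refine ⟨i, fun y hy => hi ?_⟩
      rw [mem_ball]
      by_contra! hd
      obtain ⟨L, hL, hne⟩ := hsep y x hd
      apply hne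
      have hy' : σ y = σ x := hy
      have : L ∈ σ y ↔ L ∈ σ x := by rw [hy']
      simpa [σ, hL] using this
    choose r hr using hcls
    let f : M → ι := fun x => r ⟨σ x, x, rfl⟩
    have hfU : ∀ x, x ∈ U (f x) := fun x => hr ⟨σ x, x, rfl⟩ x rfl
    have hfloc : ∀ x, x ∉ Z → ∀ᶠ y in 𝓝 x, f y = f x := by
      intro x hx
      have : ∀ᶠ y in 𝓝 x, ∀ L ∈ 𝓛, (y ∈ L ↔ x ∈ L) := by
        refine (eventually_all_finite hfin).2 fun L hL => ?_
        have hxL : x ∉ frontier L := fun h => hx (mem_biUnion hL h)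
        by_cases hxl : x ∈ L
        · have : L ∈ 𝓝 x := by
            rw [mem_frontier_iff_notMem_interior hxl, not_not] at hxL
            exact mem_interior_iff_mem_nhds.1 hxL
          filter_upwards [this] with y hy
          exact iff_of_true hy hxl
        · have : Lᶜ ∈ 𝓝 x := by
            rw [← frontier_compl, mem_frontier_iff_notMem_interior (show x ∈ Lᶜ from hxl),
              not_not] at hxL
            exact mem_interior_iff_mem_nhds.1 hxL
          filter_upwards [this] with y hy
          exact iff_of_false hy hxl
      filter_upwards [this] with y hy
      have hs : σ y = σ x := by
        ext L
        simp only [σ, mem_ofPred_eq]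
        exact and_congr_right fun hL => hy L hL
      simp only [f, hs]
    refine ⟨fun i => (V i ∩ O) ∪ {x | x ∉ Z ∧ f x = i}, ?_, ?_, ?_, ?_⟩
    · intro i
      refine ((hV i).inter hOo).union ?_
      rw [isOpen_iff_mem_nhds]
      rintro x ⟨hx, rfl⟩
      filter_upwards [hZc.isOpen_compl.mem_nhds hx, hfloc x hx] with y h1 h2
      exact ⟨h1, h2⟩
    · intro x
      by_cases hx : x ∈ Z
      · obtain ⟨i, hi⟩ := iUnion_eq_univ_iff.1 hVc x
        exact ⟨i, Or.inl ⟨hi, hZO hx⟩⟩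
      · exact ⟨f x, Or.inr ⟨hx, rfl⟩⟩
    · rintro i x (⟨hx, -⟩ | ⟨-, rfl⟩)
      · exact hWU' i (hVW i (subset_closure hx))
      · exact hfU x
    · intro x _
      have hsub : {i | x ∈ (V i ∩ O) ∪ {x | x ∉ Z ∧ f x = i}} ⊆
          {i | x ∈ V i ∩ O} ∪ {f x} := by
        rintro i (h | ⟨-, h⟩)
        · exact Or.inl h
        · exact Or.inr h.symm
      refine (Set.ncard_le_ncard hsub (Set.toFinite _)).trans ((Set.ncard_union_le _ _).trans ?_)
      rw [Set.ncard_singleton]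
      refine Nat.add_le_add_right ?_ 1
      by_cases hx : x ∈ O
      · have hsub2 : {i | x ∈ V i ∩ O} ⊆ {i | x ∈ closure (V i)} :=
          fun i hi => subset_closure (show x ∈ V i from hi.1)
        exact (Set.ncard_le_ncard hsub2 (Set.toFinite _)).trans hx
      · have : {i | x ∈ V i ∩ O} = ∅ := by
          ext i; simp [hx]
        rw [this]; simp

end SnakeHelpers

/-- **Theorem A.** If `(M, T)` is an ordered compact metric space with
`Snake(M,T) ≤ s`, then the covering dimension of `M` is at most `s`. -/
theorem covDim_le_of_snake_le
    {M : Type*} [MetricSpace M] [CompactSpace M]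
    (T : M → M → Prop) (hT : IsStrictTotalOrder M T)
    (s : ℕ) (h : snakeNumSpace T ≤ (s : ℕ∞)) :
    CovDimLE M (s : ℤ) := by
  have hk : NoSnake T (s + 1) := by
    intro x y hxy
    by_contra! hc
    have h1 : ((s + 1 : ℕ) : ℕ∞) ≤ snakeNum T x y :=
      le_iSup₂_of_le (f := fun (s : ℕ) (_ : s ∈ {s : ℕ | ∀ ε : ℝ, 0 < ε →
        HasSnake T (ball x ε) (ball y ε) s}) => (s : ℕ∞)) (s + 1) hc le_rfl
    have h2 : snakeNum T x y ≤ snakeNumSpace T :=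
      le_iSup_of_le x (le_iSup_of_le y (le_iSup_of_le hxy le_rfl))
    have h3 : s + 1 ≤ s := by exact_mod_cast (h1.trans h2).trans h
    omega
  have hmain := shrink_main s M T hT hk
  intro 𝒰 hfin hopen hcov
  haveI : Finite 𝒰 := hfin
  obtain ⟨W, hW, hWc, hWU, hWk⟩ := hmain 𝒰 (fun U => (U : Set M)) (fun U => hopen U U.2)
    (fun x => by
      have hx : x ∈ ⋃₀ 𝒰 := hcov ▸ mem_univ x
      obtain ⟨U, hU, hxU⟩ := hx
      exact ⟨⟨U, hU⟩, hxU⟩)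
  refine ⟨Set.range W, Set.finite_range W, ?_, ?_, ?_, ?_⟩
  · rintro _ ⟨i, rfl⟩
    exact hW i
  · refine eq_univ_of_forall fun x => ?_
    obtain ⟨i, hi⟩ := hWc x
    exact ⟨W i, ⟨i, rfl⟩, hi⟩
  · rintro _ ⟨i, rfl⟩
    exact ⟨i, i.2, hWU i⟩
  · intro x
    have hsub : {V ∈ Set.range W | x ∈ V} ⊆ W '' {i | x ∈ W i} := by
      rintro _ ⟨⟨i, rfl⟩, hi⟩
      exact ⟨i, hi, rfl⟩
    have h1 := (Set.ncard_le_ncard hsub (Set.toFinite _)).trans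
      ((Set.ncard_image_le (Set.toFinite _)).trans (hWk x (mem_univ x)))
    exact_mod_cast h1
end

section
/- Let M be a compact metric space with Lebesgue covering dimension dim M ≥ n. Suppose A is a closed subset of ℝ and f : A → M is a continuous surjection. Then there exist n+1 points x₀ < x₁ < ⋯ < x_n in A such that f(x₀) = f(x₂) = ⋯ = f(x_{2⌊n/2⌋}) (all even-indexed points have the same image) and f(x₁) = f(x₃) = ⋯ = f(x_{2⌈n/2⌉−1}) (all odd-indexed points have the same image). -/
open Metric Set

/-- Swelling of a finite closed family keeping the order. -/
theorem swell_aux {M ι : Type*} [MetricSpace M] [CompactSpace M] [Finite ι] (n : ℕ)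
    (B U : ι → Set M) (hB : ∀ i, IsClosed (B i)) (hU : ∀ i, IsOpen (U i))
    (hBU : ∀ i, B i ⊆ U i) (hn : ∀ y, {i | y ∈ B i}.ncard ≤ n) :
    ∃ G : ι → Set M, (∀ i, IsOpen (G i)) ∧ (∀ i, B i ⊆ G i) ∧ (∀ i, closure (G i) ⊆ U i) ∧
      ∀ y, {i | y ∈ closure (G i)}.ncard ≤ n := by
  have h1 : ∀ i, ∃ δ, 0 < δ ∧ cthickening δ (B i) ⊆ U i := fun i =>
    (hB i).isCompact.exists_cthickening_subset_open (hU i) (hBU i)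
  choose e he heU using h1
  obtain ⟨ε, hε, hεW⟩ := lebesgue_number_lemma_of_metric (s := (univ : Set M)) isCompact_univ
    (c := fun y : M => ⋂ i ∈ {i | y ∉ B i}, (B i)ᶜ)
    (fun y => (Set.toFinite _).isOpen_biInter fun i _ => (hB i).isOpen_compl)
    (fun y _ => mem_iUnion.2 ⟨y, by simp⟩)
  have hpos : ∀ i, 0 < min (ε / 2) (e i) := fun i => lt_min (by linarith) (he i)
  refine ⟨fun i => thickening (min (ε / 2) (e i)) (B i), fun i => isOpen_thickening,
    fun i => self_subset_thickening (hpos i) _, fun i => ?_, fun x => ?_⟩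
  · exact (closure_thickening_subset_cthickening _ _).trans
      ((cthickening_mono (min_le_right _ _) _).trans (heU i))
  · obtain ⟨y, hy⟩ := hεW x (mem_univ _)
    refine le_trans (ncard_le_ncard ?_ (Set.toFinite _)) (hn y)
    intro i hi
    have h2 : x ∈ thickening ε (B i) :=
      cthickening_subset_thickening' hε (lt_of_le_of_lt (min_le_left _ _) (by linarith)) _
        (closure_thickening_subset_cthickening _ _ hi)
    obtain ⟨z, hz, hxz⟩ := mem_thickening_iff.1 h2
    by_contra hyi
    have := hy (show z ∈ ball x ε by rw [mem_ball, dist_comm]; exact hxz)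
    simp only [mem_iInter] at this
    exact this i hyi hz

/-- Remove superfluous cells. -/
theorem prune_aux {M : Type*} [TopologicalSpace M] (g : ℝ → M) (K : Set ℝ) (hK : IsCompact K)
    (J : ℤ → Set ℝ) (hJ : ∀ i, IsOpen (J i)) (R : Finset ℤ) (hR : ∀ i, i ∉ R → K ∩ J i = ∅) :
    ∃ L ⊆ K, IsCompact L ∧ g '' L = g '' K ∧
      ∀ i, L ∩ J i = ∅ ∨ ∃ t ∈ L ∩ J i, ∀ s ∈ L, g s = g t → s ∈ J i := by
  classical
  let P : Finset (Finset ℤ) := R.powerset.filter fun S => g '' (K \ ⋃ i ∈ S, J i) = g '' K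
  have hP : P.Nonempty := ⟨∅, by simp [P]⟩
  obtain ⟨S, hS, hmax⟩ := Finset.exists_max_image P Finset.card hP
  obtain ⟨hSR, hSg⟩ : S ⊆ R ∧ g '' (K \ ⋃ i ∈ S, J i) = g '' K := by simpa [P] using hS
  refine ⟨K \ ⋃ i ∈ S, J i, diff_subset, hK.diff (isOpen_biUnion fun i _ => hJ i), hSg, ?_⟩
  intro i
  by_cases hiR : i ∈ R
  swap
  · left
    have := hR i hiR
    rw [← subset_empty_iff] at this ⊢
    exact fun x hx => this ⟨hx.1.1, hx.2⟩
  by_cases hiS : i ∈ S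
  · left
    rw [← subset_empty_iff]
    rintro x ⟨⟨_, hx⟩, hxi⟩
    exact hx (mem_biUnion (show i ∈ (S : Set ℤ) from hiS) hxi)
  right
  by_contra hcon
  push Not at hcon
  have hins : insert i S ∈ P := by
    simp only [P, Finset.mem_filter, Finset.mem_powerset]
    refine ⟨Finset.insert_subset hiR hSR, ?_⟩
    refine Subset.antisymm (image_mono diff_subset) ?_
    rw [← hSg]
    rintro _ ⟨t, ht, rfl⟩
    by_cases hti : t ∈ J i
    · obtain ⟨s, hs, hst, hsi⟩ := hcon t ⟨ht, hti⟩
      refine ⟨s, ⟨hs.1, ?_⟩, hst⟩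
      have := hs.2
      simp only [mem_iUnion, Finset.mem_insert, not_exists] at this ⊢
      rintro k (rfl | hk) 
      · exact hsi
      · exact this k hk
    · refine ⟨t, ⟨ht.1, ?_⟩, rfl⟩
      have := ht.2
      simp only [mem_iUnion, Finset.mem_insert, not_exists] at this ⊢
      rintro k (rfl | hk) 
      · exact hti
      · exact this k hk
  have := hmax _ hins
  rw [Finset.card_insert_of_notMem hiS] at this
  omega

/-- Fine closed cover of the image of a compact set, of small order. -/
theorem closed_cover_aux {M ι : Type*} [MetricSpace M] [Finite ι] (n : ℕ) (hn2 : 2 ≤ n)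
    (g : ℝ → M) (K : Set ℝ) (hK : IsCompact K) (hg : ContinuousOn g K)
    (hfib : ∀ S : Finset ℝ, (S : Set ℝ) ⊆ K → (∀ x ∈ S, ∀ y ∈ S, g x = g y) → S.card ≤ n)
    (U : ι → Set M) (hU : ∀ i, IsOpen (U i)) (hcov : g '' K ⊆ ⋃ i, U i) :
    ∃ B : ι → Set M, (∀ i, IsClosed (B i)) ∧ (∀ i, B i ⊆ U i) ∧ g '' K ⊆ ⋃ i, B i ∧
      ∀ y, {i | y ∈ B i}.ncard ≤ n := by
  classical
  rcases K.eq_empty_or_nonempty with rfl | ⟨k0, hk0⟩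
  · exact ⟨fun _ => ∅, fun _ => isClosed_empty, fun _ => empty_subset _, by simp, by simp⟩
  obtain ⟨δ, hδ, hLeb⟩ := lebesgue_number_lemma_of_metric (hK.image_of_continuousOn hg) hU hcov
  obtain ⟨η', hη', huc⟩ := Metric.uniformContinuousOn_iff.1
    (hK.uniformContinuousOn_of_continuous hg) δ hδ
  obtain ⟨η, hη, hηη'⟩ : ∃ η : ℝ, 0 < η ∧ 2 * η < η' := ⟨η' / 3, by linarith, by linarith⟩
  obtain ⟨r, hr⟩ := hK.isBounded.subset_closedBall 0
  obtain ⟨N, hN⟩ := exists_nat_gt (r / η)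
  rw [div_lt_iff₀ hη] at hN
  have hKN : ∀ s ∈ K, -(N * η) < s ∧ s < N * η := by
    intro s hs
    have := hr hs
    rw [mem_closedBall_zero_iff, Real.norm_eq_abs, abs_le] at this
    constructor <;> linarith [this.1, this.2]
  -- cells
  let J : ℤ → Set ℝ := fun i => Ioo (i * η) ((i + 1) * η)
  have hrange : ∀ s ∈ K, ∀ i : ℤ, (i - 1) * η < s → s < (i + 2) * η →
      i ∈ Finset.Icc (-(N : ℤ) - 2) (N + 2) := by
    intro s hs i h1 h2
    obtain ⟨h3, h4⟩ := hKN s hs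
    have h5 : ((i : ℝ) - 1) < N := lt_of_mul_lt_mul_right (h1.trans h4) hη.le
    have h6 : -(N : ℝ) < i + 2 := by
      refine lt_of_mul_lt_mul_right (a := η) ?_ hη.le
      linarith
    have h5' : i - 1 < (N : ℤ) := by exact_mod_cast h5
    have h6' : -(N : ℤ) < i + 2 := by exact_mod_cast h6
    rw [Finset.mem_Icc]; constructor <;> omega
  obtain ⟨L, hLK, hL, hLim, hLJ⟩ := prune_aux g K hK J (fun i => isOpen_Ioo)
    (Finset.Icc (-(N : ℤ) - 2) (N + 2)) (by
      intro i hi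
      rw [← subset_empty_iff]
      rintro s ⟨hs, h1, h2⟩
      exact hi (hrange s hs i (by linarith) (by linarith)))
  have ht : ∀ i : ℤ, ∃ t ∈ J i, t ∈ L → ∀ s ∈ L, g s = g t → s ∈ J i := by
    intro i
    rcases hLJ i with h | ⟨t, ht, h⟩
    · have hm : (i + 1 / 2 : ℝ) * η ∈ J i := by
        constructor <;> nlinarith
      refine ⟨_, hm, fun hl => ?_⟩
      exact absurd (show _ ∈ L ∩ J i from ⟨hl, hm⟩) (by rw [h]; exact notMem_empty _)
    · exact ⟨t, ht.2, fun _ => h⟩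
  choose t htJ htf using ht
  let C : ℤ → Set M := fun j => g '' (L ∩ Icc (t j) (t (j + 1)))
  have htb : ∀ j : ℤ, j * η < t j ∧ t j < (j + 1) * η := fun j => htJ j
  have htb' : ∀ j : ℤ, (j + 1) * η < t (j + 1) ∧ t (j + 1) < (j + 2) * η := by
    intro j
    have := htb (j + 1)
    push_cast at this
    constructor <;> linarith [this.1, this.2]
  have hgL : ContinuousOn g L := hg.mono hLK
  have hCc : ∀ j, IsClosed (C j) := fun j =>
    ((hL.inter_right isClosed_Icc).image_of_continuousOn
      (hgL.mono inter_subset_left)).isClosed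
  have hc : ∀ j, ∃ i, C j ⊆ U i := by
    intro j
    rcases (L ∩ Icc (t j) (t (j + 1))).eq_empty_or_nonempty with h | ⟨s, hs⟩
    · obtain ⟨i, _⟩ := mem_iUnion.1 (hcov ⟨k0, hk0, rfl⟩)
      exact ⟨i, by simp [C, h]⟩
    · obtain ⟨i, hi⟩ := hLeb (g s) ⟨s, hLK hs.1, rfl⟩
      refine ⟨i, ?_⟩
      rintro _ ⟨u, hu, rfl⟩
      refine hi (huc u (hLK hu.1) s (hLK hs.1) ?_)
      rw [Real.dist_eq, abs_lt]
      have h1 := htb j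
      have h2 := htb' j
      have h3 := hs.2
      have h4 := hu.2
      rw [mem_Icc] at h3 h4
      constructor <;> linarith
  choose c hcU using hc
  -- order of C
  have hord : ∀ y, {j | y ∈ C j}.Finite ∧ {j | y ∈ C j}.ncard ≤ n := by
    intro y
    have hfin : {j | y ∈ C j}.Finite := by
      refine (Finset.finite_toSet (Finset.Icc (-(N : ℤ) - 2) (N + 2))).subset ?_
      rintro j ⟨s, ⟨hs, h1, h2⟩, _⟩
      have h3 := htb j
      have h4 := htb' j
      exact hrange s (hLK hs) j (by linarith) (by linarith)
    refine ⟨hfin, ?_⟩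
    by_cases hy : ∃ i, t i ∈ L ∧ g (t i) = y
    · obtain ⟨i, hiL, rfl⟩ := hy
      have hsub : {j | g (t i) ∈ C j} ⊆ {i - 1, i} := by
        rintro j ⟨s, ⟨hs, h1, h2⟩, hgs⟩
        have h5 := htf i hiL s hs hgs
        have h3 := htb j
        have h4 := htb' j
        have h6 : (j : ℝ) < i + 1 := lt_of_mul_lt_mul_right (a := η)
          (by linarith [h5.1, h5.2]) hη.le
        have h7 : (i : ℝ) < j + 2 := lt_of_mul_lt_mul_right (a := η)
          (by linarith [h5.1, h5.2]) hη.le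
        have h6' : j < i + 1 := by exact_mod_cast h6
        have h7' : i < j + 2 := by exact_mod_cast h7
        simp only [mem_insert_iff, mem_singleton_iff]
        omega
      calc _ ≤ ({i - 1, i} : Set ℤ).ncard := ncard_le_ncard hsub (Set.toFinite _)
        _ ≤ 2 := by simpa using ncard_insert_le (i - 1) ({i} : Set ℤ)
        _ ≤ n := hn2
    · push Not at hy
      have hs : ∀ j, ∃ s, y ∈ C j → s ∈ L ∧ g s = y ∧ t j < s ∧ s < t (j + 1) := by
        intro j
        by_cases hj : y ∈ C j
        · obtain ⟨s, ⟨hs, h1, h2⟩, hgs⟩ := hj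
          refine ⟨s, fun _ => ⟨hs, hgs, lt_of_le_of_ne h1 ?_, lt_of_le_of_ne h2 ?_⟩⟩
          · intro h; exact hy j (h ▸ hs) (h ▸ hgs)
          · intro h; exact hy (j + 1) (h ▸ hs) (h ▸ hgs)
        · exact ⟨0, fun h => absurd h hj⟩
      choose s hs using hs
      have hmono : StrictMono t := by
        refine strictMono_int_of_lt_succ fun j => ?_
        linarith [(htb j).2, (htb' j).1]
      have hinj : InjOn s {j | y ∈ C j} := by
        have key : ∀ a b, y ∈ C a → y ∈ C b → a < b → s a < s b := by
          intro a b ha hb hab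
          have h1 := (hs a ha).2.2.2
          have h2 := (hs b hb).2.2.1
          have h3 : t (a + 1) ≤ t b := hmono.monotone (by omega)
          linarith
        intro a ha b hb hab
        rcases lt_trichotomy a b with h | h | h
        · exact absurd hab (key a b ha hb h).ne
        · exact h
        · exact absurd hab (key b a hb ha h).ne'
      have h1 := hfib (hfin.toFinset.image s) (by
        intro x hx
        simp only [Finset.coe_image, Set.Finite.coe_toFinset] at hx
        obtain ⟨j, hj, rfl⟩ := hx
        exact hLK (hs j hj).1) (by
        intro x hx x' hx'
        simp only [Finset.mem_image, Set.Finite.mem_toFinset] at hx hx'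
        obtain ⟨j, hj, rfl⟩ := hx
        obtain ⟨j', hj', rfl⟩ := hx'
        rw [(hs j hj).2.1, (hs j' hj').2.1])
      rw [Finset.card_image_of_injOn (by simpa using hinj)] at h1
      rwa [ncard_eq_toFinset_card _ hfin]
  refine ⟨fun i => ⋃ j ∈ (Finset.Icc (-(N : ℤ) - 2) (N + 2)).filter (fun j => c j = i), C j,
    fun i => ?_, fun i => ?_, ?_, fun y => ?_⟩
  · exact isClosed_biUnion_finset fun j _ => hCc j
  · refine iUnion₂_subset fun j hj => ?_
    rw [Finset.mem_filter] at hj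
    rw [← hj.2]; exact hcU j
  · rw [← hLim]
    rintro _ ⟨s, hs, rfl⟩
    have hex : ∃ j, s ∈ Icc (t j) (t (j + 1)) := by
      have h1 : (⌊s / η⌋ : ℝ) * η ≤ s := by
        rw [← le_div_iff₀ hη]; exact Int.floor_le _
      have h2 : s < ((⌊s / η⌋ : ℝ) + 1) * η := by
        rw [← div_lt_iff₀ hη]; exact Int.lt_floor_add_one _
      rcases le_total (t ⌊s / η⌋) s with h | h
      · exact ⟨_, h, by linarith [(htb' ⌊s / η⌋).1]⟩
      · refine ⟨⌊s / η⌋ - 1, ?_, by simpa using h⟩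
        have := (htb (⌊s / η⌋ - 1)).2
        push_cast at this
        linarith
    obtain ⟨j, hj⟩ := hex
    refine mem_iUnion.2 ⟨c j, mem_iUnion₂.2 ⟨j, ?_, ⟨s, ⟨hs, hj⟩, rfl⟩⟩⟩
    rw [Finset.mem_filter]
    exact ⟨hrange s (hLK hs) j (by linarith [(htb j).1, hj.1]) (by linarith [(htb' j).2, hj.2]),
      rfl⟩
  · refine le_trans (ncard_le_ncard (t := c '' {j | y ∈ C j}) ?_ ((hord y).1.image c)) ?_
    · intro i hi
      obtain ⟨j, hj, hyj⟩ := mem_iUnion₂.1 (show y ∈ ⋃ j ∈ _, C j from hi)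
      rw [Finset.mem_filter] at hj
      exact ⟨j, hyj, hj.2⟩
    · exact (ncard_image_le (hord y).1).trans (hord y).2

/-- One shrinking step. -/
theorem step_aux {M ι : Type*} [MetricSpace M] [CompactSpace M] [Finite ι] (n : ℕ) (hn2 : 2 ≤ n)
    (g : ℝ → M) (K : Set ℝ) (hK : IsCompact K) (hg : ContinuousOn g K)
    (hfib : ∀ S : Finset ℝ, (S : Set ℝ) ⊆ K → (∀ x ∈ S, ∀ y ∈ S, g x = g y) → S.card ≤ n)
    (U : ι → Set M) (hU : ∀ i, IsOpen (U i)) (hcov : ⋃ i, U i = univ) :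
    ∃ W : ι → Set M, (∀ i, IsOpen (W i)) ∧ (⋃ i, W i = univ) ∧ (∀ i, closure (W i) ⊆ U i) ∧
      ∀ y ∈ g '' K, {i | y ∈ closure (W i)}.ncard ≤ n := by
  obtain ⟨B, hBc, hBU, hBcov, hBn⟩ := closed_cover_aux n hn2 g K hK hg hfib U hU
    (by rw [hcov]; exact subset_univ _)
  obtain ⟨G, hGo, hBG, hGU, hGn⟩ := swell_aux n B U hBc hU hBU hBn
  obtain ⟨U', hU'cov, hU'o, hU'U⟩ := exists_iUnion_eq_closure_subset hU
    (fun x => Set.toFinite _) hcov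
  have hF : IsClosed (g '' K) := (hK.image_of_continuousOn hg).isClosed
  obtain ⟨H, hHo, hFH, hHG⟩ := normal_exists_closure_subset hF (isOpen_iUnion hGo)
    (hBcov.trans (iUnion_mono hBG))
  refine ⟨fun i => G i ∪ (U' i \ closure H), fun i => (hGo i).union
    ((hU'o i).sdiff isClosed_closure), ?_, fun i => ?_, fun y hy => ?_⟩
  · refine eq_univ_of_forall fun x => ?_
    by_cases hx : x ∈ closure H
    · obtain ⟨i, hi⟩ := mem_iUnion.1 (hHG hx)
      exact mem_iUnion.2 ⟨i, Or.inl hi⟩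
    · obtain ⟨i, hi⟩ := mem_iUnion.1 (hU'cov.symm ▸ mem_univ x : x ∈ ⋃ i, U' i)
      exact mem_iUnion.2 ⟨i, Or.inr ⟨hi, hx⟩⟩
  · rw [closure_union]
    exact union_subset (hGU i) ((closure_mono diff_subset).trans (hU'U i))
  · refine le_trans (ncard_le_ncard ?_ (Set.toFinite _)) (hGn y)
    intro i hi
    rw [mem_setOf_eq, closure_union] at hi
    rcases hi with hi | hi
    · exact hi
    · exfalso
      have : closure (U' i \ closure H) ⊆ Hᶜ :=
        closure_minimal (fun z hz hzH => hz.2 (subset_closure hzH)) hHo.isClosed_compl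
      exact this hi (hFH hy)

/-- Bounded fibres force small dimension. -/
theorem covDimLE_aux {M : Type*} [MetricSpace M] [CompactSpace M] (n : ℕ) (hn2 : 2 ≤ n)
    (g : ℝ → M) (A : Set ℝ) (hA : IsClosed A) (hg : ContinuousOn g A) (hs : g '' A = univ)
    (hfib : ∀ S : Finset ℝ, (S : Set ℝ) ⊆ A → (∀ x ∈ S, ∀ y ∈ S, g x = g y) → S.card ≤ n) :
    CovDimLE M ((n : ℤ) - 1) := by
  intro 𝒰 hfin hopen hcov
  have : Finite 𝒰 := hfin
  let T := {W : 𝒰 → Set M // (∀ i, IsOpen (W i)) ∧ ⋃ i, W i = univ}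
  let K : ℕ → Set ℝ := fun k => A ∩ Icc (-(k : ℝ)) k
  have hstep : ∀ (k : ℕ) (U : T), ∃ W : T, (∀ i, closure (W.1 i) ⊆ U.1 i) ∧
      ∀ y ∈ g '' K k, {i | y ∈ closure (W.1 i)}.ncard ≤ n := by
    intro k U
    obtain ⟨W, h1, h2, h3, h4⟩ := step_aux n hn2 g (K k) (isCompact_Icc.inter_left hA)
      (hg.mono inter_subset_left) (fun S hS => hfib S (hS.trans inter_subset_left)) U.1 U.2.1 U.2.2
    exact ⟨⟨W, h1, h2⟩, h3, h4⟩
  choose F hF1 hF2 using hstep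
  let U0 : T := ⟨fun i => i.1, fun i => hopen i.1 i.2, by rw [← sUnion_eq_iUnion, hcov]⟩
  let W : ℕ → T := fun k => Nat.rec U0 (fun k U => F k U) k
  have hW1 : ∀ k i, closure ((W (k + 1)).1 i) ⊆ (W k).1 i := fun k => hF1 k (W k)
  have hW2 : ∀ k, ∀ y ∈ g '' K k, {i | y ∈ closure ((W (k + 1)).1 i)}.ncard ≤ n :=
    fun k => hF2 k (W k)
  have hanti : ∀ i, Antitone fun k => (W k).1 i := fun i =>
    antitone_nat_of_succ_le fun k => subset_closure.trans (hW1 k i)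
  let B : 𝒰 → Set M := fun i => ⋂ k, closure ((W (k + 1)).1 i)
  have hBU : ∀ i, B i ⊆ i.1 := fun i => (iInter_subset _ 0).trans (hW1 0 i)
  have hBn : ∀ y, {i | y ∈ B i}.ncard ≤ n := by
    intro y
    obtain ⟨s, hsA, rfl⟩ : y ∈ g '' A := hs ▸ mem_univ y
    obtain ⟨k, hk⟩ := exists_nat_ge |s|
    refine le_trans (ncard_le_ncard ?_ (Set.toFinite _))
      (hW2 k (g s) ⟨s, ⟨hsA, abs_le.1 hk⟩, rfl⟩)
    intro i hi
    exact mem_iInter.1 hi k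
  have hBcov : ∀ y, ∃ i, y ∈ B i := by
    intro y
    by_contra hcon
    push Not at hcon
    have : ∀ i, ∃ k, y ∉ (W k).1 i := by
      intro i
      have := hcon i
      simp only [B, mem_iInter, not_forall] at this
      obtain ⟨k, hk⟩ := this
      exact ⟨k + 1, fun h => hk (subset_closure h)⟩
    choose k hk using this
    obtain ⟨m, hm⟩ := (Set.finite_range k).bddAbove
    obtain ⟨i, hi⟩ := mem_iUnion.1 ((W m).2.2.symm ▸ mem_univ y : y ∈ ⋃ i, (W m).1 i)
    exact hk i (hanti i (hm ⟨i, rfl⟩) hi)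
  obtain ⟨G, hGo, hBG, hGU, hGn⟩ := swell_aux n B (fun i => i.1)
    (fun i => isClosed_iInter fun k => isClosed_closure) (fun i => hopen i.1 i.2) hBU hBn
  refine ⟨range G, Set.finite_range G, ?_, ?_, ?_, fun x => ?_⟩
  · rintro _ ⟨i, rfl⟩; exact hGo i
  · refine eq_univ_of_forall fun y => ?_
    obtain ⟨i, hi⟩ := hBcov y
    exact ⟨G i, ⟨i, rfl⟩, hBG i hi⟩
  · rintro _ ⟨i, rfl⟩
    exact ⟨i.1, i.2, subset_closure.trans (hGU i)⟩
  · have h1 : {V ∈ range G | x ∈ V}.ncard ≤ n := by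
      refine le_trans (ncard_le_ncard (t := G '' {i | x ∈ closure (G i)}) ?_ (Set.toFinite _))
        ((ncard_image_le (Set.toFinite _)).trans (hGn x))
      rintro _ ⟨⟨i, rfl⟩, hx⟩
      exact ⟨i, subset_closure hx, rfl⟩
    have : ({V ∈ range G | x ∈ V}.ncard : ℤ) ≤ n := by exact_mod_cast h1
    linarith

/-- If `M` is a compact metric space with covering dimension `≥ n` and `f : A → M`
is a continuous surjection from a closed subset `A ⊆ ℝ`, then there are points
`x₀ < x₁ < ⋯ < x_n` in `A` whose even-indexed images coincide and whose
odd-indexed images coincide. -/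
theorem exists_increasing_points_with_equal_images_of_covDim_ge
    {M : Type*} [MetricSpace M] [CompactSpace M]
    (n : ℕ) (hdim : ¬ CovDimLE M ((n : ℤ) - 1))
    (A : Set ℝ) (hA : IsClosed A)
    (f : A → M) (hf : Continuous f) (hsurj : Function.Surjective f) :
    ∃ x : Fin (n + 1) → A,
      (∀ i j : Fin (n + 1), i < j → (x i : ℝ) < (x j : ℝ)) ∧
      (∀ i j : Fin (n + 1), Even (i : ℕ) → Even (j : ℕ) → f (x i) = f (x j)) ∧
      (∀ i j : Fin (n + 1), Odd (i : ℕ) → Odd (j : ℕ) → f (x i) = f (x j)) := by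
  classical
  rcases isEmpty_or_nonempty M with hM | hM
  · exact absurd (fun 𝒰 _ _ _ => ⟨∅, Set.finite_empty, by simp, by
      simpa using (Subsingleton.elim _ _), by simp, fun x => isEmptyElim x⟩) hdim
  obtain ⟨y0⟩ := hM
  obtain ⟨a0, ha0⟩ := hsurj y0
  rcases Nat.lt_or_ge n 2 with hn | hn
  · have hn' : n = 0 ∨ n = 1 := by omega
    rcases hn' with rfl | rfl
    · refine ⟨fun _ => a0, fun i j hij => ?_, fun _ _ _ _ => rfl, fun _ _ _ _ => rfl⟩
      omega
    · have key : ∃ a b : A, (a : ℝ) < b := by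
        by_contra hcon
        push Not at hcon
        have hall : ∀ y : M, y = y0 := by
          intro y
          obtain ⟨a, rfl⟩ := hsurj y
          rw [← ha0]
          congr 1
          exact Subtype.ext (le_antisymm (hcon _ _) (hcon _ _))
        apply hdim
        intro 𝒰 _ _ hcov
        obtain ⟨U, hU, hyU⟩ : y0 ∈ ⋃₀ 𝒰 := hcov ▸ mem_univ y0
        refine ⟨{univ}, Set.finite_singleton _, by simp, by simp, ?_, fun x => ?_⟩
        · rintro V _
          exact ⟨U, hU, fun z _ => hall z ▸ hyU⟩
        · have : {V ∈ ({univ} : Set (Set M)) | x ∈ V}.ncard ≤ 1 :=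
            (ncard_le_ncard (sep_subset _ _) (Set.toFinite _)).trans (ncard_singleton _).le
          have : ({V ∈ ({univ} : Set (Set M)) | x ∈ V}.ncard : ℤ) ≤ 1 := by exact_mod_cast this
          simpa using this
      obtain ⟨a, b, hab⟩ := key
      refine ⟨![a, b], ?_, ?_, ?_⟩ <;> intro i j <;> fin_cases i <;> fin_cases j <;> simp [hab]
  by_contra hcon
  apply hdim
  let g : ℝ → M := fun x => if h : x ∈ A then f ⟨x, h⟩ else y0
  have hgf : ∀ x : A, g x = f x := fun x => by simp [g]
  refine covDimLE_aux n hn g A hA ?_ ?_ ?_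
  · rw [continuousOn_iff_continuous_restrict]
    convert hf using 1
    funext x
    exact hgf x
  · refine eq_univ_of_forall fun y => ?_
    obtain ⟨a, rfl⟩ := hsurj y
    exact ⟨a, a.2, hgf a⟩
  · intro S hSA hSg
    by_contra hlt
    obtain ⟨S', hS', hcard⟩ := Finset.exists_subset_card_eq (show n + 1 ≤ S.card by omega)
    have hmem : ∀ i, S'.orderEmbOfFin hcard i ∈ S := fun i =>
      hS' (Finset.orderEmbOfFin_mem _ _ _)
    have hall : ∀ i j, f ⟨S'.orderEmbOfFin hcard i, hSA (hmem i)⟩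
        = f ⟨S'.orderEmbOfFin hcard j, hSA (hmem j)⟩ := by
      intro i j
      rw [← hgf, ← hgf]
      exact hSg _ (hmem i) _ (hmem j)
    exact hcon ⟨fun i => ⟨S'.orderEmbOfFin hcard i, hSA (hmem i)⟩,
      fun i j hij => (S'.orderEmbOfFin hcard).strictMono hij,
      fun i j _ _ => hall i j, fun i j _ _ => hall i j⟩
end
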